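/- arXiv:2311.00459 — 2 statements merged into one kernel-verified Lean document; each statement's English description precedes it below -/
import Mathlib

section
/- Let φ : g₂^α → g₂^α be a linear map. If α ≠ −1, then φ is a Lie algebra automorphism of g₂^α if and only if there exist λ₁₁, λ₂₁, λ₁₃, λ₂₃ ∈ ℂ with λ₁₁(λ₁₁ + λ₂₁(α−1)) ≠ 0 such that φ(e₁) = λ₁₁ e₁ + λ₂₁ e₂, φ(e₂) = (λ₁₁ + λ₂₁(α−1)) e₂, φ(e₃) = λ₁₃ e₁ + λ₂₃ e₂ + e₃. If α = −1, then φ is a Lie algebra automorphism if and only if either φ has the previous form with α = −1 (i.e. φ(e₂) = (λ₁₁ − 2λ₂₁) e₂ and λ₁₁(λ₁₁ − 2λ₂₁) ≠ 0), or there exist λ₁₁, λ₂₁, λ₁₃, λ₂₃ ∈ ℂ with λ₁₁² ≠ 2λ₁₁λ₂₁ such that φ(e₁) = λ₁₁ e₁ + λ₂₁ e₂, φ(e₂) = −2λ₁₁ e₁ − λ₁₁ e₂, φ(e₃) = λ₁₃ e₁ + λ₂₃ e₂ − e₃. -/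
noncomputable section

abbrev V3 : Type := Fin 3 → ℂ

def e (i : Fin 3) : V3 := Pi.single i 1

def bg2 (α : ℂ) : V3 → V3 → V3 := fun x y => ![(x 0 * y 2 - x 2 * y 0), (x 0 * y 2 - x 2 * y 0) + (α * (x 1 * y 2 - x 2 * y 1)), (0 : ℂ)]

theorem bijective_iff_det_ne_zero (φ : V3 →ₗ[ℂ] V3) :
    Function.Bijective φ ↔ (LinearMap.toMatrix' φ).det ≠ 0 := by
  rw [LinearMap.det_toMatrix', ← isUnit_iff_ne_zero, ← LinearMap.isUnit_iff_isUnit_det,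
    Module.End.isUnit_iff]

theorem apply_eq_basis_sum (φ : V3 →ₗ[ℂ] V3) (x : V3) :
    φ x = x 0 • φ (e 0) + x 1 • φ (e 1) + x 2 • φ (e 2) := by
  conv_lhs => rw [LinearMap.pi_apply_eq_sum_univ φ x]
  have h (i : Fin 3) : (fun j => if i = j then (1 : ℂ) else 0) = e i := by
    ext j
    simp [e, Pi.single_apply, eq_comm]
  simp only [h, Fin.sum_univ_three]

/-- A linear map preserves the bracket as soon as it does so on the three pairs of basis vectors. -/
theorem map_bg2_iff (α : ℂ) (φ : V3 →ₗ[ℂ] V3) :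
    (∀ x y, φ (bg2 α x y) = bg2 α (φ x) (φ y)) ↔
      φ (e 0) + φ (e 1) = bg2 α (φ (e 0)) (φ (e 2)) ∧
      α • φ (e 1) = bg2 α (φ (e 1)) (φ (e 2)) ∧
      0 = bg2 α (φ (e 0)) (φ (e 1)) := by
  constructor
  · intro h
    refine ⟨?_, ?_, ?_⟩
    · rw [← h, apply_eq_basis_sum φ (bg2 _ _ _)]
      simp [bg2, e]
    · rw [← h, apply_eq_basis_sum φ (bg2 _ _ _)]
      simp [bg2, e]
    · rw [← h, apply_eq_basis_sum φ (bg2 _ _ _)]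
      simp [bg2, e]
  · rintro ⟨h₁, h₂, h₃⟩ x y
    rw [apply_eq_basis_sum φ (bg2 _ _ _), apply_eq_basis_sum φ x, apply_eq_basis_sum φ y]
    ext i
    have h₁ := congrFun h₁
    have h₂ := congrFun h₂
    have h₃ := congrFun h₃
    simp only [bg2, Fin.forall_fin_succ, Pi.add_apply, Pi.smul_apply, smul_eq_mul] at h₁ h₂ h₃
    simp at h₁ h₂ h₃
    obtain ⟨a₁, a₂, a₃⟩ := h₁
    obtain ⟨b₁, b₂, b₃⟩ := h₂
    obtain ⟨c₁, c₂⟩ := h₃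
    fin_cases i
    · simp [bg2]
      linear_combination (x 0 * y 2 - x 2 * y 0) * a₁ + (x 1 * y 2 - x 2 * y 1) * b₁
        + (x 0 * y 1 - x 1 * y 0) * c₁
    · simp [bg2]
      linear_combination (x 0 * y 2 - x 2 * y 0) * a₂ + (x 1 * y 2 - x 2 * y 1) * b₂
        + (x 0 * y 1 - x 1 * y 0) * c₂
    · simp [bg2]
      rcases b₃ with b₃ | b₃
      · linear_combination (x 0 * y 2 - x 2 * y 0) * a₃ +
          (x 1 * y 2 - x 2 * y 1) * φ (e 1) 2 * b₃
      · linear_combination (x 0 * y 2 - x 2 * y 0) * a₃ + (x 1 * y 2 - x 2 * y 1) * α * b₃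

/-- Coordinate form of the automorphism condition: `(a, b, c)`, `(p, q, r)`, `(u, v, t)` are the
images of the basis vectors. -/
def IsAutCoords (α a b c p q r u v t : ℂ) : Prop :=
  a * q * t - a * v * r - p * b * t + p * v * c + u * b * r - u * q * c ≠ 0 ∧
    (a + p = a * t - c * u ∧ b + q = a * t - c * u + α * (b * t - c * v) ∧ c + r = 0) ∧
    (α * p = p * t - r * u ∧ α * q = p * t - r * u + α * (q * t - r * v) ∧ α * r = 0) ∧
    (0 = a * r - c * p ∧ 0 = a * r - c * p + α * (b * r - c * q))

theorem isAut_iff_coords (α : ℂ) (φ : V3 →ₗ[ℂ] V3) :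
    (Function.Bijective φ ∧ ∀ x y, φ (bg2 α x y) = bg2 α (φ x) (φ y)) ↔
      IsAutCoords α (φ (e 0) 0) (φ (e 0) 1) (φ (e 0) 2) (φ (e 1) 0) (φ (e 1) 1) (φ (e 1) 2)
        (φ (e 2) 0) (φ (e 2) 1) (φ (e 2) 2) := by
  have hM (i j : Fin 3) : LinearMap.toMatrix' φ i j = φ (e j) i := by
    simp [LinearMap.toMatrix'_apply, e]
  rw [bijective_iff_det_ne_zero, map_bg2_iff, Matrix.det_fin_three]
  simp only [hM, IsAutCoords, funext_iff, Fin.forall_fin_succ, bg2]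
  simp

theorem IsAutCoords.eq_zero {α a b c p q r u v t : ℂ} (h : IsAutCoords α a b c p q r u v t) :
    c = 0 ∧ r = 0 := by
  obtain ⟨hd, ⟨h₁, h₂, h₃⟩, ⟨h₄, h₅, h₆⟩, h₇, h₈⟩ := h
  obtain rfl : c = -r := by linear_combination h₃
  suffices r = 0 by simp [this]
  by_contra hr
  obtain rfl : α = 0 := by simpa [hr] using h₆
  have hp : a + p = 0 := by
    apply mul_left_cancel₀ hr
    linear_combination -h₇
  have hq : b + q = 0 := by linear_combination h₂ - h₁ + hp
  apply hd
  linear_combination (q * t - v * r) * hp + (u * r - p * t) * hq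

/-- The automorphisms split into those acting by `1` and by `-1` modulo the ideal spanned by the
first two basis vectors; the latter exist only for `α = -1`. -/
theorem isAutCoords_iff {α a b c p q r u v t : ℂ} :
    IsAutCoords α a b c p q r u v t ↔
      (a * (a + b * (α - 1)) ≠ 0 ∧ c = 0 ∧ p = 0 ∧ q = a + b * (α - 1) ∧ r = 0 ∧ t = 1) ∨
      (α = -1 ∧ a ^ 2 ≠ 2 * a * b ∧ c = 0 ∧ p = -(2 * a) ∧ q = -a ∧ r = 0 ∧ t = -1) := by
  constructor
  · intro h
    obtain ⟨rfl, rfl⟩ := h.eq_zero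
    obtain ⟨hd, ⟨h₁, h₂, -⟩, ⟨h₄, h₅, -⟩, -, -⟩ := h
    have ht : t ≠ 0 := by rintro rfl; simp at hd
    by_cases hp : p = 0
    · subst hp
      have ha : a ≠ 0 := by rintro rfl; simp at hd
      obtain rfl : t = 1 := by
        apply mul_left_cancel₀ ha
        linear_combination -h₁
      obtain rfl : q = a + b * (α - 1) := by linear_combination h₂
      left
      refine ⟨?_, rfl, rfl, rfl, rfl, rfl⟩
      intro h
      apply hd
      linear_combination h
    · obtain rfl : t = α := by
        apply mul_left_cancel₀ hp
        linear_combination -h₄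
      have hp' : p = a * (t - 1) := by linear_combination h₁
      have hα : t - 1 ≠ 0 := by
        intro h
        simp [hp', h] at hp
      have hq : q = -a := by
        apply mul_left_cancel₀ hα
        apply mul_left_cancel₀ ht
        linear_combination -h₅ - t * hp'
      subst hq hp'
      have hdet : a * (a + b * (t - 1)) ≠ 0 := by
        intro h
        apply hd
        linear_combination -t * h
      obtain rfl : t = -1 := by
        have : (t + 1) * (a + b * (t - 1)) = 0 := by linear_combination -h₂
        rcases mul_eq_zero.mp this with h | h
        · linear_combination h
        · exact absurd h (right_ne_zero_of_mul hdet)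
      right
      refine ⟨rfl, ?_, rfl, by ring, rfl, rfl, rfl⟩
      intro h
      apply hdet
      linear_combination h
  · rintro (⟨hd, rfl, rfl, rfl, rfl, rfl⟩ | ⟨rfl, hd, rfl, rfl, rfl, rfl, rfl⟩)
    · refine ⟨?_, ⟨by ring, by ring, by ring⟩, ⟨by ring, by ring, by ring⟩, by ring, by ring⟩
      intro h
      apply hd
      linear_combination h
    · refine ⟨?_, ⟨by ring, by ring, by ring⟩, ⟨by ring, by ring, by ring⟩, by ring, by ring⟩
      intro h
      apply hd
      linear_combination h

theorem exists_form_one_iff (α : ℂ) (φ : V3 →ₗ[ℂ] V3) :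
    (∃ l11 l21 l13 l23 : ℂ, l11 * (l11 + l21 * (α - 1)) ≠ 0 ∧
      φ (e 0) = l11 • e 0 + l21 • e 1 ∧
      φ (e 1) = (l11 + l21 * (α - 1)) • e 1 ∧
      φ (e 2) = l13 • e 0 + l23 • e 1 + e 2) ↔
    φ (e 0) 0 * (φ (e 0) 0 + φ (e 0) 1 * (α - 1)) ≠ 0 ∧ φ (e 0) 2 = 0 ∧ φ (e 1) 0 = 0 ∧
      φ (e 1) 1 = φ (e 0) 0 + φ (e 0) 1 * (α - 1) ∧ φ (e 1) 2 = 0 ∧ φ (e 2) 2 = 1 := by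
  constructor
  · rintro ⟨l11, l21, l13, l23, hd, h₀, h₁, h₂⟩
    rw [h₀, h₁, h₂]
    simpa [e] using hd
  · rintro ⟨hd, hc, hp, hq, hr, ht⟩
    refine ⟨φ (e 0) 0, φ (e 0) 1, φ (e 2) 0, φ (e 2) 1, hd, ?_, ?_, ?_⟩ <;> ext i <;>
      fin_cases i <;> simp [e] <;> assumption

theorem exists_form_neg_one_iff (φ : V3 →ₗ[ℂ] V3) :
    (∃ l11 l21 l13 l23 : ℂ, l11 ^ 2 ≠ 2 * l11 * l21 ∧
      φ (e 0) = l11 • e 0 + l21 • e 1 ∧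
      φ (e 1) = (-(2 * l11)) • e 0 + (-l11) • e 1 ∧
      φ (e 2) = l13 • e 0 + l23 • e 1 - e 2) ↔
    φ (e 0) 0 ^ 2 ≠ 2 * φ (e 0) 0 * φ (e 0) 1 ∧ φ (e 0) 2 = 0 ∧ φ (e 1) 0 = -(2 * φ (e 0) 0) ∧
      φ (e 1) 1 = -φ (e 0) 0 ∧ φ (e 1) 2 = 0 ∧ φ (e 2) 2 = -1 := by
  constructor
  · rintro ⟨l11, l21, l13, l23, hd, h₀, h₁, h₂⟩
    rw [h₀, h₁, h₂]
    simpa [e] using hd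
  · rintro ⟨hd, hc, hp, hq, hr, ht⟩
    refine ⟨φ (e 0) 0, φ (e 0) 1, φ (e 2) 0, φ (e 2) 1, hd, ?_, ?_, ?_⟩ <;> ext i <;>
      fin_cases i <;> simp [e] <;> assumption

theorem statement8 (α : ℂ) (φ : V3 →ₗ[ℂ] V3) :
    (α ≠ -1 →
      ((Function.Bijective φ ∧ ∀ x y, φ (bg2 α x y) = bg2 α (φ x) (φ y)) ↔
        (∃ l11 l21 l13 l23 : ℂ, l11 * (l11 + l21 * (α - 1)) ≠ 0 ∧
          φ (e 0) = l11 • e 0 + l21 • e 1 ∧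
          φ (e 1) = (l11 + l21 * (α - 1)) • e 1 ∧
          φ (e 2) = l13 • e 0 + l23 • e 1 + e 2))) ∧
    (α = -1 →
      ((Function.Bijective φ ∧ ∀ x y, φ (bg2 α x y) = bg2 α (φ x) (φ y)) ↔
        ((∃ l11 l21 l13 l23 : ℂ, l11 * (l11 - 2 * l21) ≠ 0 ∧
          φ (e 0) = l11 • e 0 + l21 • e 1 ∧
          φ (e 1) = (l11 - 2 * l21) • e 1 ∧
          φ (e 2) = l13 • e 0 + l23 • e 1 + e 2) ∨
        (∃ l11 l21 l13 l23 : ℂ, l11 ^ 2 ≠ 2 * l11 * l21 ∧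
          φ (e 0) = l11 • e 0 + l21 • e 1 ∧
          φ (e 1) = (-(2 * l11)) • e 0 + (-l11) • e 1 ∧
          φ (e 2) = l13 • e 0 + l23 • e 1 - e 2)))) := by
  rw [isAut_iff_coords, isAutCoords_iff, ← exists_form_one_iff, exists_form_neg_one_iff]
  refine ⟨fun hα => by simp only [hα, false_and, or_false], ?_⟩
  rintro rfl
  have h (x y : ℂ) : x + y * (-1 - 1) = x - 2 * y := by ring
  simp only [h, true_and]
end
end

section
/- Let (L, ·, [·,·]) be a 3-dimensional complex transposed Poisson algebra in which the multiplication · and the bracket [·,·] are not both zero. Then (L, ·, [·,·]) is isomorphic to one of the following algebras, given by their nonzero products on a basis e₁, e₂, e₃ (· is commutative, [·,·] is anticommutative; parameters α, β ∈ ℂ, γ ∈ ℂ, γ ≠ 0): T₀₁: [e₁,e₂]=e₃, [e₁,e₃]=−e₂, [e₂,e₃]=e₁; T₀₂: e₂·e₂=e₃, [e₁,e₂]=e₃; T₀₃^β: e₁·e₂=βe₃, [e₁,e₂]=e₃; T₀₄^β: e₁·e₂=βe₃, e₂·e₂=e₁, [e₁,e₂]=e₃; T₀₅: e₁·e₁=e₃,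 e₁·e₂=e₁, e₂·e₂=e₂, e₂·e₃=e₃, [e₁,e₂]=e₃; T₀₆: e₁·e₂=e₁, e₂·e₂=e₂, e₂·e₃=e₃, [e₁,e₂]=e₃; T₀₇^β: e₁·e₃=βe₁, e₂·e₃=βe₂, e₃·e₃=βe₃, [e₁,e₃]=e₁, [e₂,e₃]=e₂; T₀₈: e₃·e₃=e₁, [e₁,e₃]=e₁, [e₂,e₃]=e₂; T₀₉^{α,β}: e₁·e₃=βe₁, e₂·e₃=βe₂, e₃·e₃=βe₃, [e₁,e₃]=e₁+e₂, [e₂,e₃]=αe₂; T₁₀^α: e₃·e₃=e₂, [e₁,e₃]=e₁+e₂, [e₂,e₃]=αe₂; T₁₁^α: e₃·e₃=e₁, [e₁,e₃]=e₁+e₂, [e₂,e₃]=αe₂; T₁₂^β: e₁·e₁=e₂, e₁·e₃=βe₁, e₂·e₃=βe₂, e₃·e₃=βe₃, [e₁,e₃]=e₁+e₂, [e₂,e₃]=2e₂; T₁₃: e₁·e₁=e₂, e₃·e₃=e₂, [e₁,e₃]=e₁+e₂, [e₂,e₃]=2e₂; T₁₄: e₁·e₃=e₂, e₃·e₃=e₁,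 [e₁,e₃]=e₁+e₂, [e₂,e₃]=2e₂; T₁₅: e₁·e₃=e₂, [e₁,e₃]=e₁+e₂, [e₂,e₃]=2e₂; T₁₆: e₃·e₃=e₁+e₂, [e₁,e₃]=e₁+e₂; T₁₇^β: e₁·e₁=e₂, e₁·e₂=−e₂, e₁·e₃=βe₁, e₂·e₂=e₂, e₂·e₃=βe₂, e₃·e₃=βe₃, [e₁,e₃]=e₁+e₂; T₁₈: e₁·e₁=e₂, e₁·e₂=−e₂, e₂·e₂=e₂, e₃·e₃=e₁+e₂, [e₁,e₃]=e₁+e₂; T₁₉^γ: e₁·e₃=γe₁+γe₂, e₃·e₃=γe₃, [e₁,e₃]=e₁+e₂; and the algebras with zero bracket T₂₀: e₁·e₁=e₁, e₂·e₂=e₂, e₃·e₃=e₃; T₂₁: e₁·e₁=e₁, e₂·e₂=e₂, e₁·e₃=e₃; T₂₂: e₁·e₁=e₁, e₂·e₂=e₂; T₂₃: e₁·e₁=e₁, e₁·e₂=e₂, e₁·e₃=e₃, e₂·e₂=e₃; T₂₄: e₁·e₁=e₁, e₁·e₂=e₂, e₁·e₃=e₃; T₂₅: e₁·e₁=e₁,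 e₁·e₂=e₂; T₂₆: e₁·e₁=e₁, e₂·e₂=e₃; T₂₇: e₁·e₁=e₁; T₂₈: e₁·e₁=e₂, e₁·e₂=e₃; T₂₉: e₁·e₂=e₃; T₃₀: e₁·e₁=e₂. Moreover, two algebras from this list are isomorphic only if they have the same label and the same parameters, with exactly the following exceptions: T₀₃^{β₁} ≅ T₀₃^{β₂} if and only if β₁ = ±β₂; T₀₉^{α₁,β₁} ≅ T₀₉^{α₂,β₂} if and only if (α₂,β₂) = (α₁,β₁) or (α₂,β₂) = (1/α₁, β₁/α₁); T₁₁^{α₁} ≅ T₁₁^{α₂} if and only if α₂ = α₁ or α₂ = 1/α₁. -/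
noncomputable section

def Bilinear {L : Type*} [AddCommGroup L] [Module ℂ L] (m : L → L → L) : Prop :=
  (∀ (a : ℂ) (x y z : L), m (a • x + y) z = a • m x z + m y z) ∧
  (∀ (a : ℂ) (x y z : L), m x (a • y + z) = a • m x y + m x z)

def IsoPair {L M : Type*} [AddCommGroup L] [Module ℂ L] [AddCommGroup M] [Module ℂ M]
    (m₁ b₁ : L → L → L) (m₂ b₂ : M → M → M) : Prop :=
  ∃ φ : L ≃ₗ[ℂ] M, (∀ x y, φ (m₁ x y) = m₂ (φ x) (φ y)) ∧ (∀ x y, φ (b₁ x y) = b₂ (φ x) (φ y))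

def bsl2 : V3 → V3 → V3 := fun x y => ![(x 1 * y 2 - x 2 * y 1), (-(x 0 * y 2 - x 2 * y 0)), (x 0 * y 1 - x 1 * y 0)]

def bh : V3 → V3 → V3 := fun x y => ![(0 : ℂ), (0 : ℂ), (x 0 * y 1 - x 1 * y 0)]

def bg1 : V3 → V3 → V3 := fun x y => ![(x 0 * y 2 - x 2 * y 0), (x 1 * y 2 - x 2 * y 1), (0 : ℂ)]

def mT02 : V3 → V3 → V3 := fun x y => ![(0 : ℂ), (0 : ℂ), (x 1 * y 1)]

def mT05 : V3 → V3 → V3 := fun x y => ![(x 0 * y 1 + x 1 * y 0), (x 1 * y 1), (x 0 * y 0) + (x 1 * y 2 + x 2 * y 1)]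

def mT06 : V3 → V3 → V3 := fun x y => ![(x 0 * y 1 + x 1 * y 0), (x 1 * y 1), (x 1 * y 2 + x 2 * y 1)]

def mT08 : V3 → V3 → V3 := fun x y => ![(x 2 * y 2), (0 : ℂ), (0 : ℂ)]

def mT10 : V3 → V3 → V3 := fun x y => ![(0 : ℂ), (x 2 * y 2), (0 : ℂ)]

def mT11 : V3 → V3 → V3 := fun x y => ![(x 2 * y 2), (0 : ℂ), (0 : ℂ)]

def mT13 : V3 → V3 → V3 := fun x y => ![(0 : ℂ), (x 0 * y 0) + (x 2 * y 2), (0 : ℂ)]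

def mT14 : V3 → V3 → V3 := fun x y => ![(x 2 * y 2), (x 0 * y 2 + x 2 * y 0), (0 : ℂ)]

def mT15 : V3 → V3 → V3 := fun x y => ![(0 : ℂ), (x 0 * y 2 + x 2 * y 0), (0 : ℂ)]

def mT16 : V3 → V3 → V3 := fun x y => ![(x 2 * y 2), (x 2 * y 2), (0 : ℂ)]

def mT18 : V3 → V3 → V3 := fun x y => ![(x 2 * y 2), (x 0 * y 0) + (-(x 0 * y 1 + x 1 * y 0)) + (x 1 * y 1) + (x 2 * y 2), (0 : ℂ)]

def mT20 : V3 → V3 → V3 := fun x y => ![(x 0 * y 0), (x 1 * y 1), (x 2 * y 2)]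

def mT21 : V3 → V3 → V3 := fun x y => ![(x 0 * y 0), (x 1 * y 1), (x 0 * y 2 + x 2 * y 0)]

def mT22 : V3 → V3 → V3 := fun x y => ![(x 0 * y 0), (x 1 * y 1), (0 : ℂ)]

def mT23 : V3 → V3 → V3 := fun x y => ![(x 0 * y 0), (x 0 * y 1 + x 1 * y 0), (x 0 * y 2 + x 2 * y 0) + (x 1 * y 1)]

def mT24 : V3 → V3 → V3 := fun x y => ![(x 0 * y 0), (x 0 * y 1 + x 1 * y 0), (x 0 * y 2 + x 2 * y 0)]

def mT25 : V3 → V3 → V3 := fun x y => ![(x 0 * y 0), (x 0 * y 1 + x 1 * y 0), (0 : ℂ)]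

def mT26 : V3 → V3 → V3 := fun x y => ![(x 0 * y 0), (0 : ℂ), (x 1 * y 1)]

def mT27 : V3 → V3 → V3 := fun x y => ![(x 0 * y 0), (0 : ℂ), (0 : ℂ)]

def mT28 : V3 → V3 → V3 := fun x y => ![(0 : ℂ), (x 0 * y 0), (x 0 * y 1 + x 1 * y 0)]

def mT29 : V3 → V3 → V3 := fun x y => ![(0 : ℂ), (0 : ℂ), (x 0 * y 1 + x 1 * y 0)]

def mT30 : V3 → V3 → V3 := fun x y => ![(0 : ℂ), (x 0 * y 0), (0 : ℂ)]

def mT03 (β : ℂ) : V3 → V3 → V3 := fun x y => ![(0 : ℂ), (0 : ℂ), (β * (x 0 * y 1 + x 1 * y 0))]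

def mT04 (β : ℂ) : V3 → V3 → V3 := fun x y => ![(x 1 * y 1), (0 : ℂ), (β * (x 0 * y 1 + x 1 * y 0))]

def mT07 (β : ℂ) : V3 → V3 → V3 := fun x y => ![(β * (x 0 * y 2 + x 2 * y 0)), (β * (x 1 * y 2 + x 2 * y 1)), (β * (x 2 * y 2))]

def mT09 (β : ℂ) : V3 → V3 → V3 := fun x y => ![(β * (x 0 * y 2 + x 2 * y 0)), (β * (x 1 * y 2 + x 2 * y 1)), (β * (x 2 * y 2))]

def mT12 (β : ℂ) : V3 → V3 → V3 := fun x y => ![(β * (x 0 * y 2 + x 2 * y 0)), (x 0 * y 0) + (β * (x 1 * y 2 + x 2 * y 1)), (β * (x 2 * y 2))]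

def mT17 (β : ℂ) : V3 → V3 → V3 := fun x y => ![(β * (x 0 * y 2 + x 2 * y 0)), (x 0 * y 0) + (-(x 0 * y 1 + x 1 * y 0)) + (x 1 * y 1) + (β * (x 1 * y 2 + x 2 * y 1)), (β * (x 2 * y 2))]

def mT19 (γ : ℂ) : V3 → V3 → V3 := fun x y => ![(γ * (x 0 * y 2 + x 2 * y 0)), (γ * (x 0 * y 2 + x 2 * y 0)), (γ * (x 2 * y 2))]

inductive TIdx where
  | t01 | t02
  | t03 (β : ℂ) | t04 (β : ℂ)
  | t05 | t06
  | t07 (β : ℂ) | t08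
  | t09 (α β : ℂ) | t10 (α : ℂ) | t11 (α : ℂ)
  | t12 (β : ℂ) | t13 | t14 | t15 | t16
  | t17 (β : ℂ) | t18 | t19 (γ : ℂ)
  | t20 | t21 | t22 | t23 | t24 | t25 | t26 | t27 | t28 | t29 | t30

def tMul : TIdx → V3 → V3 → V3
  | .t01 => fun _ _ => 0
  | .t02 => mT02
  | .t03 β => mT03 β
  | .t04 β => mT04 β
  | .t05 => mT05
  | .t06 => mT06
  | .t07 β => mT07 β
  | .t08 => mT08
  | .t09 _ β => mT09 β
  | .t10 _ => mT10
  | .t11 _ => mT11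
  | .t12 β => mT12 β
  | .t13 => mT13
  | .t14 => mT14
  | .t15 => mT15
  | .t16 => mT16
  | .t17 β => mT17 β
  | .t18 => mT18
  | .t19 γ => mT19 γ
  | .t20 => mT20
  | .t21 => mT21
  | .t22 => mT22
  | .t23 => mT23
  | .t24 => mT24
  | .t25 => mT25
  | .t26 => mT26
  | .t27 => mT27
  | .t28 => mT28
  | .t29 => mT29
  | .t30 => mT30

def tBr : TIdx → V3 → V3 → V3
  | .t01 => bsl2
  | .t02 => bh
  | .t03 _ => bh
  | .t04 _ => bh
  | .t05 => bh
  | .t06 => bh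
  | .t07 _ => bg1
  | .t08 => bg1
  | .t09 α _ => bg2 α
  | .t10 α => bg2 α
  | .t11 α => bg2 α
  | .t12 _ => bg2 2
  | .t13 => bg2 2
  | .t14 => bg2 2
  | .t15 => bg2 2
  | .t16 => bg2 0
  | .t17 _ => bg2 0
  | .t18 => bg2 0
  | .t19 _ => bg2 0
  | _ => fun _ _ => 0

def tValid : TIdx → Prop
  | .t19 γ => γ ≠ 0
  | _ => True

def tRel : TIdx → TIdx → Prop
  | .t03 β₁, .t03 β₂ => β₁ = β₂ ∨ β₁ = -β₂
  | .t09 α₁ β₁, .t09 α₂ β₂ => (α₂ = α₁ ∧ β₂ = β₁) ∨ (α₁ ≠ 0 ∧ α₂ = 1/α₁ ∧ β₂ = β₁/α₁)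
  | .t11 α₁, .t11 α₂ => α₂ = α₁ ∨ (α₁ ≠ 0 ∧ α₂ = 1/α₁)
  | i, j => i = j

structure TPA (m b : V3 → V3 → V3) : Prop where
  mul : Bilinear m
  br : Bilinear b
  comm : ∀ x y, m x y = m y x
  assoc : ∀ x y z, m (m x y) z = m x (m y z)
  alt : ∀ x, b x x = 0
  jac : ∀ x y z, b (b x y) z + b (b y z) x + b (b z x) y = 0
  compat : ∀ x y z, (2 : ℂ) • m z (b x y) = b (m z x) y + b x (m z y)

def Classified (m b : V3 → V3 → V3) : Prop :=
  ∃ i : TIdx, tValid i ∧ IsoPair m b (tMul i) (tBr i)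

lemma IsoPair.refl (m b : V3 → V3 → V3) : IsoPair m b m b :=
  ⟨LinearEquiv.refl ℂ V3, fun _ _ => rfl, fun _ _ => rfl⟩

lemma IsoPair.symm {m b m' b' : V3 → V3 → V3} (h : IsoPair m b m' b') : IsoPair m' b' m b := by
  obtain ⟨φ, h1, h2⟩ := h
  refine ⟨φ.symm, fun x y => ?_, fun x y => ?_⟩
  · rw [LinearEquiv.symm_apply_eq, h1]; simp
  · rw [LinearEquiv.symm_apply_eq, h2]; simp

lemma IsoPair.trans {m b m' b' m'' b'' : V3 → V3 → V3} (h : IsoPair m b m' b')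
    (h' : IsoPair m' b' m'' b'') : IsoPair m b m'' b'' := by
  obtain ⟨φ, h1, h2⟩ := h
  obtain ⟨ψ, h3, h4⟩ := h'
  exact ⟨φ.trans ψ, fun x y => by simp [h1, h3], fun x y => by simp [h2, h4]⟩

lemma Classified.of_iso {m b m' b' : V3 → V3 → V3} (h : IsoPair m b m' b')
    (h' : Classified m' b') : Classified m b := by
  obtain ⟨i, hi, h''⟩ := h'
  exact ⟨i, hi, h.trans h''⟩

def transport (φ : V3 ≃ₗ[ℂ] V3) (m : V3 → V3 → V3) : V3 → V3 → V3 :=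
  fun x y => φ (m (φ.symm x) (φ.symm y))

lemma isoPair_transport (φ : V3 ≃ₗ[ℂ] V3) (m b : V3 → V3 → V3) :
    IsoPair m b (transport φ m) (transport φ b) :=
  ⟨φ, fun x y => by simp [transport], fun x y => by simp [transport]⟩

lemma Bilinear.transport {m : V3 → V3 → V3} (h : Bilinear m) (φ : V3 ≃ₗ[ℂ] V3) :
    Bilinear (transport φ m) :=
  ⟨fun a x y z => by simp [_root_.transport, h.1], fun a x y z => by simp [_root_.transport, h.2]⟩

lemma TPA.transport {m b : V3 → V3 → V3} (h : TPA m b) (φ : V3 ≃ₗ[ℂ] V3) :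
    TPA (transport φ m) (transport φ b) where
  mul := h.mul.transport φ
  br := h.br.transport φ
  comm x y := by simp only [_root_.transport]; rw [h.comm]
  assoc x y z := by simp [_root_.transport, h.assoc]
  alt x := by simp [_root_.transport, h.alt]
  jac x y z := by
    simp only [_root_.transport, LinearEquiv.symm_apply_apply, ← map_add, h.jac, map_zero]
  compat x y z := by
    simp only [_root_.transport, LinearEquiv.symm_apply_apply, ← map_add, ← map_smul, h.compat]

def comb (u v w x : V3) : V3 :=
  ![x 0 * u 0 + x 1 * v 0 + x 2 * w 0, x 0 * u 1 + x 1 * v 1 + x 2 * w 1,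
    x 0 * u 2 + x 1 * v 2 + x 2 * w 2]

def det3 (u v w : V3) : ℂ :=
  u 0 * (v 1 * w 2 - v 2 * w 1) - u 1 * (v 0 * w 2 - v 2 * w 0) + u 2 * (v 0 * w 1 - v 1 * w 0)

lemma ext3 {x y : V3} (h0 : x 0 = y 0) (h1 : x 1 = y 1) (h2 : x 2 = y 2) : x = y := by
  ext k; fin_cases k <;> assumption

lemma exists_frameEquiv (u v w : V3) (h : det3 u v w ≠ 0) :
    ∃ φ : V3 ≃ₗ[ℂ] V3, ∀ x, φ.symm x = comb u v w x := by
  let f : V3 →ₗ[ℂ] V3 :=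
    { toFun := comb u v w
      map_add' := fun x y => by apply ext3 <;> simp [comb] <;> ring
      map_smul' := fun a x => by apply ext3 <;> simp [comb] <;> ring }
  have hf : Function.Injective f := by
    rw [injective_iff_map_eq_zero]
    intro x hx
    have e0 : x 0 * u 0 + x 1 * v 0 + x 2 * w 0 = 0 := congrFun hx 0
    have e1 : x 0 * u 1 + x 1 * v 1 + x 2 * w 1 = 0 := congrFun hx 1
    have e2 : x 0 * u 2 + x 1 * v 2 + x 2 * w 2 = 0 := congrFun hx 2
    apply ext3 <;> refine (mul_eq_zero.1 ?_).resolve_right h <;> unfold det3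
    · linear_combination (v 1 * w 2 - v 2 * w 1) * e0 - (v 0 * w 2 - v 2 * w 0) * e1
        + (v 0 * w 1 - v 1 * w 0) * e2
    · linear_combination -(u 1 * w 2 - u 2 * w 1) * e0 + (u 0 * w 2 - u 2 * w 0) * e1
        - (u 0 * w 1 - u 1 * w 0) * e2
    · linear_combination (u 1 * v 2 - u 2 * v 1) * e0 - (u 0 * v 2 - u 2 * v 0) * e1
        + (u 0 * v 1 - u 1 * v 0) * e2
  exact ⟨(LinearEquiv.ofInjectiveEndo f hf).symm, fun x => rfl⟩

lemma isoPair_of_frame {m b μ β : V3 → V3 → V3} (u v w : V3) (h : det3 u v w ≠ 0)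
    (h1 : ∀ x y, comb u v w (μ x y) = m (comb u v w x) (comb u v w y))
    (h2 : ∀ x y, comb u v w (β x y) = b (comb u v w x) (comb u v w y)) :
    IsoPair m b μ β := by
  obtain ⟨φ, hφ⟩ := exists_frameEquiv u v w h
  refine ⟨φ, fun x y => ?_, fun x y => ?_⟩
  · rw [← LinearEquiv.eq_symm_apply, hφ, h1, ← hφ, ← hφ]; simp
  · rw [← LinearEquiv.eq_symm_apply, hφ, h2, ← hφ, ← hφ]; simp

def LieIso (b b' : V3 → V3 → V3) : Prop := ∃ φ : V3 ≃ₗ[ℂ] V3, transport φ b = b'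

lemma lieIso_of_frame {b β : V3 → V3 → V3} (u v w : V3) (h : det3 u v w ≠ 0)
    (h2 : ∀ x y, comb u v w (β x y) = b (comb u v w x) (comb u v w y)) : LieIso b β := by
  obtain ⟨φ, hφ⟩ := exists_frameEquiv u v w h
  refine ⟨φ, funext fun x => funext fun y => ?_⟩
  rw [transport, ← LinearEquiv.eq_symm_apply, hφ, hφ, hφ, h2]

lemma LieIso.trans {b b' b'' : V3 → V3 → V3} (h : LieIso b b') (h' : LieIso b' b'') :
    LieIso b b'' := by
  obtain ⟨φ, rfl⟩ := h
  obtain ⟨ψ, rfl⟩ := h'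
  exact ⟨φ.trans ψ, rfl⟩

lemma LieIso.exists_isoPair {m b b' : V3 → V3 → V3} (h : LieIso b b') (hT : TPA m b) :
    ∃ m', TPA m' b' ∧ IsoPair m b m' b' := by
  obtain ⟨φ, rfl⟩ := h
  exact ⟨transport φ m, hT.transport φ, isoPair_transport φ m b⟩

def mulOf (p q r s t u : V3) : V3 → V3 → V3 := fun x y =>
  ![x 0 * y 0 * p 0 + (x 0 * y 1 + x 1 * y 0) * q 0 + (x 0 * y 2 + x 2 * y 0) * r 0
      + x 1 * y 1 * s 0 + (x 1 * y 2 + x 2 * y 1) * t 0 + x 2 * y 2 * u 0,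
    x 0 * y 0 * p 1 + (x 0 * y 1 + x 1 * y 0) * q 1 + (x 0 * y 2 + x 2 * y 0) * r 1
      + x 1 * y 1 * s 1 + (x 1 * y 2 + x 2 * y 1) * t 1 + x 2 * y 2 * u 1,
    x 0 * y 0 * p 2 + (x 0 * y 1 + x 1 * y 0) * q 2 + (x 0 * y 2 + x 2 * y 0) * r 2
      + x 1 * y 1 * s 2 + (x 1 * y 2 + x 2 * y 1) * t 2 + x 2 * y 2 * u 2]

def brOf (p q r : V3) : V3 → V3 → V3 := fun x y =>
  ![(x 0 * y 1 - x 1 * y 0) * p 0 + (x 0 * y 2 - x 2 * y 0) * q 0 + (x 1 * y 2 - x 2 * y 1) * r 0,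
    (x 0 * y 1 - x 1 * y 0) * p 1 + (x 0 * y 2 - x 2 * y 0) * q 1 + (x 1 * y 2 - x 2 * y 1) * r 1,
    (x 0 * y 1 - x 1 * y 0) * p 2 + (x 0 * y 2 - x 2 * y 0) * q 2 + (x 1 * y 2 - x 2 * y 1) * r 2]

lemma eq_sum_e (x : V3) : x = x 0 • e 0 + (x 1 • e 1 + (x 2 • e 2 + 0)) := by
  apply ext3 <;> simp [e]

lemma Bilinear.map_zero_left {m : V3 → V3 → V3} (h : Bilinear m) (y : V3) : m 0 y = 0 := by
  simpa using h.1 (-1) 0 0 y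

lemma Bilinear.map_zero_right {m : V3 → V3 → V3} (h : Bilinear m) (y : V3) : m y 0 = 0 := by
  simpa using h.2 (-1) y 0 0

lemma Bilinear.exists_mulOf {m : V3 → V3 → V3} (h : Bilinear m) (hc : ∀ x y, m x y = m y x) :
    ∃ p q r s t u, m = mulOf p q r s t u := by
  refine ⟨m (e 0) (e 0), m (e 0) (e 1), m (e 0) (e 2), m (e 1) (e 1), m (e 1) (e 2),
    m (e 2) (e 2), funext fun x => funext fun y => ?_⟩
  conv_lhs => rw [eq_sum_e x, eq_sum_e y]
  simp only [h.1, h.2, h.map_zero_left, h.map_zero_right]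
  rw [hc (e 1) (e 0), hc (e 2) (e 0), hc (e 2) (e 1)]
  apply ext3 <;> simp [mulOf] <;> ring

lemma Bilinear.exists_brOf {b : V3 → V3 → V3} (h : Bilinear b) (ha : ∀ x, b x x = 0) :
    ∃ p q r, b = brOf p q r := by
  have hs : ∀ x y, b x y = - b y x := by
    intro x y
    have h0 := ha ((1 : ℂ) • x + y)
    rw [h.1, h.2, h.2, ha, ha] at h0
    simp only [one_smul, zero_add, add_zero] at h0
    exact eq_neg_of_add_eq_zero_left h0
  refine ⟨b (e 0) (e 1), b (e 0) (e 2), b (e 1) (e 2), funext fun x => funext fun y => ?_⟩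
  conv_lhs => rw [eq_sum_e x, eq_sum_e y]
  simp only [h.1, h.2, h.map_zero_left, h.map_zero_right, ha]
  rw [hs (e 1) (e 0), hs (e 2) (e 0), hs (e 2) (e 1)]
  apply ext3 <;> simp [brOf] <;> ring

lemma lieIso_brOf_of_frame {P Q R p q r : V3} (u v w : V3) (h : det3 u v w ≠ 0)
    (huv : brOf P Q R u v = comb u v w p) (huw : brOf P Q R u w = comb u v w q)
    (hvw : brOf P Q R v w = comb u v w r) : LieIso (brOf P Q R) (brOf p q r) := by
  refine lieIso_of_frame u v w h fun x y => ?_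
  have key : ∀ k, comb u v w (brOf p q r x y) k = (x 0 * y 1 - x 1 * y 0) * comb u v w p k
      + (x 0 * y 2 - x 2 * y 0) * comb u v w q k + (x 1 * y 2 - x 2 * y 1) * comb u v w r k := by
    intro k; fin_cases k <;> simp [comb, brOf] <;> ring
  apply ext3 <;> rw [key, ← huv, ← huw, ← hvw] <;> simp [comb, brOf] <;> ring

lemma bsl2_eq : bsl2 = brOf ![0, 0, 1] ![0, -1, 0] ![1, 0, 0] := by
  funext x y; apply ext3 <;> simp [bsl2, brOf]

lemma bh_eq : bh = brOf ![0, 0, 1] ![0, 0, 0] ![0, 0, 0] := by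
  funext x y; apply ext3 <;> simp [bh, brOf]

lemma bg1_eq : bg1 = brOf ![0, 0, 0] ![1, 0, 0] ![0, 1, 0] := by
  funext x y; apply ext3 <;> simp [bg1, brOf]

lemma bg2_eq (α : ℂ) : bg2 α = brOf ![0, 0, 0] ![1, 1, 0] ![0, α, 0] := by
  funext x y; apply ext3 <;> simp [bg2, brOf]; ring

def symForm (a b c d f g : ℂ) (x y : V3) : ℂ :=
  a * (x 0 * y 0) + b * (x 0 * y 1 + x 1 * y 0) + c * (x 0 * y 2 + x 2 * y 0) + d * (x 1 * y 1)
    + f * (x 1 * y 2 + x 2 * y 1) + g * (x 2 * y 2)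

lemma symForm_exists_unit {a b c d f g : ℂ} {x : V3} (hx : symForm a b c d f g x x ≠ 0) :
    ∃ t : ℂ, symForm a b c d f g (t • x) (t • x) = 1 := by
  obtain ⟨s, hs⟩ := IsAlgClosed.exists_pow_nat_eq (symForm a b c d f g x x) (n := 2) (by norm_num)
  have hs0 : s ≠ 0 := by rintro rfl; apply hx; rw [← hs]; norm_num
  refine ⟨s⁻¹, ?_⟩
  have : symForm a b c d f g (s⁻¹ • x) (s⁻¹ • x) = s⁻¹ ^ 2 * symForm a b c d f g x x := by
    simp [symForm]; ring
  rw [this, ← hs]; field_simp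

lemma symForm_exists_orthonormal {a b c d f g : ℂ}
    (h : a * (d * g - f * f) - b * (b * g - c * f) + c * (b * f - c * d) ≠ 0) :
    ∃ u v, symForm a b c d f g u u = 1 ∧ symForm a b c d f g v v = 1 ∧
      symForm a b c d f g u v = 0 := by
  obtain ⟨u, hu⟩ : ∃ u, symForm a b c d f g u u = 1 := by
    by_contra! hn
    have h0 : ∀ x, symForm a b c d f g x x = 0 := by
      intro x; by_contra hx
      obtain ⟨t, ht⟩ := symForm_exists_unit hx
      exact hn _ ht
    have e0 := h0 ![1, 0, 0]
    have e1 := h0 ![0, 1, 0]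
    have e2 := h0 ![0, 0, 1]
    have e3 := h0 ![1, 1, 0]
    have e4 := h0 ![1, 0, 1]
    simp [symForm] at e0 e1 e2 e3 e4
    apply h
    simp_all
  set l : V3 → ℂ := fun x => symForm a b c d f g u x with hl
  obtain ⟨v, hv, huv⟩ : ∃ v, symForm a b c d f g v v ≠ 0 ∧ symForm a b c d f g u v = 0 := by
    by_contra! hn
    have h0 : ∀ x, symForm a b c d f g x x = l x ^ 2 := by
      intro x
      have h1 : symForm a b c d f g u (x - l x • u) = l x - l x * symForm a b c d f g u u := by
        simp only [hl, symForm, Pi.sub_apply, Pi.smul_apply, smul_eq_mul]; ring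
      have h2 : symForm a b c d f g (x - l x • u) (x - l x • u)
          = symForm a b c d f g x x - 2 * l x * l x + l x ^ 2 * symForm a b c d f g u u := by
        simp only [hl, symForm, Pi.sub_apply, Pi.smul_apply, smul_eq_mul]; ring
      rw [hu] at h1 h2
      by_contra hx
      refine hn _ (fun h3 => hx ?_) (by rw [h1]; ring)
      rw [h2] at h3
      linear_combination h3
    have e0 := h0 ![1, 0, 0]
    have e1 := h0 ![0, 1, 0]
    have e2 := h0 ![0, 0, 1]
    have e3 := h0 ![1, 1, 0]
    have e4 := h0 ![1, 0, 1]
    have e5 := h0 ![0, 1, 1]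
    have l3 : l ![1, 1, 0] = l ![1, 0, 0] + l ![0, 1, 0] := by simp [hl, symForm]; ring
    have l4 : l ![1, 0, 1] = l ![1, 0, 0] + l ![0, 0, 1] := by simp [hl, symForm]; ring
    have l5 : l ![0, 1, 1] = l ![0, 1, 0] + l ![0, 0, 1] := by simp [hl, symForm]; ring
    rw [l3] at e3; rw [l4] at e4; rw [l5] at e5
    generalize l ![1, 0, 0] = A at *
    generalize l ![0, 1, 0] = B at *
    generalize l ![0, 0, 1] = C at *
    simp [symForm] at e0 e1 e2 e3 e4 e5
    have hb : b = A * B := by linear_combination (e3 - e0 - e1) / 2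
    have hc : c = A * C := by linear_combination (e4 - e0 - e2) / 2
    have hf : f = B * C := by linear_combination (e5 - e1 - e2) / 2
    apply h; rw [hb, hc, hf, e0, e1, e2]; ring
  obtain ⟨t, ht⟩ := symForm_exists_unit hv
  refine ⟨u, t • v, hu, ht, ?_⟩
  have : symForm a b c d f g u (t • v) = t * symForm a b c d f g u v := by
    simp [symForm]; ring
  rw [this, huv, mul_zero]

lemma lieIso_bsl2 {A B C D E F : ℂ}
    (h : A * (D * F - E * E) - B * (B * F - C * E) + C * (B * E - C * D) ≠ 0) :
    LieIso (brOf ![C, E, F] ![-B, -D, -E] ![A, B, C]) bsl2 := by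
  obtain ⟨u, v, hu, hv, huv⟩ := symForm_exists_orthonormal (a := D * F - E * E)
    (b := C * E - B * F) (c := B * E - C * D) (d := A * F - C * C) (f := B * C - A * E)
    (g := A * D - B * B) (by
      intro h0
      apply pow_ne_zero 2 h
      rw [← h0]; ring)
  simp only [symForm] at hu hv huv
  rw [bsl2_eq]
  refine lieIso_brOf_of_frame u v (brOf ![C, E, F] ![-B, -D, -E] ![A, B, C] u v) ?_ ?_ ?_ ?_
  · intro h0
    have : (A * (D * F - E * E) - B * (B * F - C * E) + C * (B * E - C * D)) *
        det3 u v (brOf ![C, E, F] ![-B, -D, -E] ![A, B, C] u v) = 1 := by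
      rw [← sub_zero (1 : ℂ), ← mul_one (1 : ℂ), ← mul_zero (0 : ℂ)]
      nth_rw 1 [← hu, ← hv]
      rw [← huv]
      simp [det3, brOf]
      ring
    simp [h0] at this
  · apply ext3 <;> simp [comb]
  · apply ext3 <;> simp [comb, brOf]
    · linear_combination u 0 * huv - v 0 * hu
    · linear_combination u 1 * huv - v 1 * hu
    · linear_combination u 2 * huv - v 2 * hu
  · apply ext3 <;> simp [comb, brOf]
    · linear_combination u 0 * hv - v 0 * huv
    · linear_combination u 1 * hv - v 1 * huv
    · linear_combination u 2 * hv - v 2 * huv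

structure IsLie (b : V3 → V3 → V3) : Prop where
  br : Bilinear b
  alt : ∀ x, b x x = 0
  jac : ∀ x y z, b (b x y) z + b (b y z) x + b (b z x) y = 0

lemma IsLie.of_lieIso {b b' : V3 → V3 → V3} (h : LieIso b b') (hb : IsLie b) : IsLie b' := by
  obtain ⟨φ, rfl⟩ := h
  refine ⟨hb.br.transport φ, fun x => by simp [transport, hb.alt], fun x y z => ?_⟩
  simp only [transport, LinearEquiv.symm_apply_apply, ← map_add, hb.jac, map_zero]

inductive StdBracket : (V3 → V3 → V3) → Prop
  | zero : StdBracket (fun _ _ => 0)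
  | sl2 : StdBracket bsl2
  | heis : StdBracket bh
  | g1 : StdBracket bg1
  | g2 (α : ℂ) : 2 * α ≠ 1 → StdBracket (bg2 α)

def HasStdForm (b : V3 → V3 → V3) : Prop := ∃ b', StdBracket b' ∧ LieIso b b'

lemma HasStdForm.of_lieIso {b b' : V3 → V3 → V3} (h : LieIso b b') (h' : HasStdForm b') :
    HasStdForm b := by
  obtain ⟨c, hc, hc'⟩ := h'
  exact ⟨c, hc, h.trans hc'⟩

lemma lieIso_bg2_inv {α : ℂ} (h0 : α ≠ 0) (h1 : α ≠ 1) : LieIso (bg2 α) (bg2 α⁻¹) := by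
  have h2 : 1 - α ≠ 0 := sub_ne_zero.2 h1.symm
  refine lieIso_of_frame ![1, 0, 0] ![α⁻¹ - 1, α⁻¹, 0] ![0, 0, α⁻¹] (by simp [det3, h0]) ?_
  intro x y
  apply ext3 <;> simp [comb, bg2] <;> field_simp <;> ring

lemma hasStdForm_bg2 (α : ℂ) : HasStdForm (bg2 α) := by
  by_cases h : 2 * α = 1
  · have h0 : α ≠ 0 := by rintro rfl; simp at h
    have h1 : α ≠ 1 := by rintro rfl; norm_num at h
    refine .of_lieIso (lieIso_bg2_inv h0 h1) ⟨_, .g2 α⁻¹ ?_, ⟨LinearEquiv.refl ℂ V3, rfl⟩⟩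
    rw [eq_div_of_mul_eq (by norm_num : (2 : ℂ) ≠ 0) ((mul_comm _ _).trans h)]
    norm_num
  · exact ⟨_, .g2 α h, ⟨LinearEquiv.refl ℂ V3, rfl⟩⟩

lemma StdBracket.hasStdForm {b : V3 → V3 → V3} (h : StdBracket b) : HasStdForm b :=
  ⟨b, h, ⟨LinearEquiv.refl ℂ V3, rfl⟩⟩

/-- `ad e₂` acts on the abelian ideal `⟨e₀, e₁⟩` by a companion matrix. -/
lemma hasStdForm_companion (t v : ℂ) :
    HasStdForm (brOf ![0, 0, 0] ![0, 1, 0] ![t, v, 0]) := by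
  obtain ⟨s, hs⟩ := IsAlgClosed.exists_pow_nat_eq (v ^ 2 + 4 * t) (n := 2) (by norm_num)
  obtain ⟨a, c, rfl, rfl⟩ : ∃ a c : ℂ, v = a + c ∧ t = - (a * c) :=
    ⟨(v + s) / 2, (v - s) / 2, by ring, by linear_combination -hs / 4⟩
  clear hs
  wlog ha : a ≠ 0 generalizing a c
  · by_cases hc : c = 0
    · obtain rfl := not_not.1 ha
      subst hc
      refine .of_lieIso ?_ StdBracket.heis.hasStdForm
      rw [bh_eq]
      exact lieIso_brOf_of_frame ![1, 0, 0] ![0, 0, 1] ![0, 1, 0] (by simp [det3])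
        (by apply ext3 <;> simp [comb, brOf]) (by apply ext3 <;> simp [comb, brOf])
        (by apply ext3 <;> simp [comb, brOf])
    · have := this c a hc
      rwa [add_comm, mul_comm] at this
  refine .of_lieIso ?_ (hasStdForm_bg2 (c / a))
  rw [bg2_eq]
  refine lieIso_brOf_of_frame ![1, 0, 0] ![-1, a⁻¹, 0] ![0, 0, a⁻¹] (by simp [det3, ha]) ?_ ?_ ?_
  all_goals apply ext3 <;> simp [comb, brOf]
  all_goals field_simp
  all_goals ring

lemma hasStdForm_of_abelian_ideal (q0 q1 r0 r1 : ℂ) :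
    HasStdForm (brOf ![0, 0, 0] ![q0, q1, 0] ![r0, r1, 0]) := by
  by_cases hq : q1 = 0
  · by_cases hr : r0 = 0
    · subst hq hr
      by_cases hd : q0 = r1
      · subst hd
        by_cases h0 : q0 = 0
        · subst h0
          convert StdBracket.zero.hasStdForm using 1
          funext x y; apply ext3 <;> simp [brOf]
        · refine .of_lieIso ?_ StdBracket.g1.hasStdForm
          rw [bg1_eq]
          exact lieIso_brOf_of_frame ![1, 0, 0] ![0, 1, 0] ![0, 0, q0⁻¹] (by simp [det3, h0])
            (by apply ext3 <;> simp [comb, brOf]) (by apply ext3 <;> simp [comb, brOf, h0])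
            (by apply ext3 <;> simp [comb, brOf, h0])
      · refine .of_lieIso ?_ (hasStdForm_companion (- q0 * r1) (q0 + r1))
        refine lieIso_brOf_of_frame ![1, 1, 0] ![q0, r1, 0] ![0, 0, 1] ?_ ?_ ?_ ?_
        · simp only [det3]; simp; intro h; apply hd; linear_combination -h
        all_goals apply ext3 <;> simp [comb, brOf]
        all_goals ring
    · refine .of_lieIso ?_ (hasStdForm_companion (r0 * q1 - q0 * r1) (q0 + r1))
      refine lieIso_brOf_of_frame ![0, 1, 0] ![r0, r1, 0] ![0, 0, 1] (by simp [det3, hr]) ?_ ?_ ?_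
      all_goals apply ext3 <;> simp [comb, brOf]
      all_goals ring
  · refine .of_lieIso ?_ (hasStdForm_companion (r0 * q1 - q0 * r1) (q0 + r1))
    refine lieIso_brOf_of_frame ![1, 0, 0] ![q0, q1, 0] ![0, 0, 1] (by simp [det3, hq]) ?_ ?_ ?_
    all_goals apply ext3 <;> simp [comb, brOf]
    all_goals ring

lemma hasStdForm_of_nonabelian_ideal {q0 q1 r0 r1 : ℂ}
    (h : IsLie (brOf ![1, 0, 0] ![q0, q1, 0] ![r0, r1, 0])) :
    HasStdForm (brOf ![1, 0, 0] ![q0, q1, 0] ![r0, r1, 0]) := by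
  have h0 := congrFun (h.jac (e 0) (e 1) (e 2)) 0
  have h1 := congrFun (h.jac (e 0) (e 1) (e 2)) 1
  simp [brOf, e] at h0 h1
  refine .of_lieIso ?_ (hasStdForm_bg2 0)
  rw [bg2_eq]
  refine lieIso_brOf_of_frame ![1 - r0, q0, -1] ![r0, -q0, 1] ![0, 1, 0]
    (by simp [det3]; ring_nf; norm_num) ?_ ?_ ?_
  all_goals apply ext3 <;> simp [comb, brOf]
  all_goals grind

lemma exists_frame_coord {l : V3} (hl : l ≠ 0) :
    ∃ φ : V3 ≃ₗ[ℂ] V3, ∀ x, φ x 2 = l 0 * x 0 + l 1 * x 1 + l 2 * x 2 := by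
  obtain ⟨u, v, w, hd, h⟩ : ∃ u v w, det3 u v w ≠ 0 ∧ ∀ y, l 0 * comb u v w y 0
      + l 1 * comb u v w y 1 + l 2 * comb u v w y 2 = y 2 := by
    by_cases h2 : l 2 = 0
    · by_cases h1 : l 1 = 0
      · have h0 : l 0 ≠ 0 := fun h0 => hl (ext3 h0 h1 h2)
        exact ⟨![0, 1, 0], ![0, 0, 1], ![(l 0)⁻¹, 0, 0], by simp [det3, h0],
          fun y => by simp [comb, h1, h2]; field_simp⟩
      · exact ⟨![l 1, -l 0, 0], ![0, 0, 1], ![0, (l 1)⁻¹, 0], by simp [det3, h1],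
          fun y => by simp [comb, h2]; field_simp; ring⟩
    · exact ⟨![l 2, 0, -l 0], ![0, l 2, -l 1], ![0, 0, (l 2)⁻¹], by simp [det3, h2],
          fun y => by simp [comb]; field_simp; ring⟩
  obtain ⟨φ, hφ⟩ := exists_frameEquiv u v w hd
  refine ⟨φ, fun x => ?_⟩
  rw [← h (φ x), ← hφ, φ.symm_apply_apply]

lemma hasStdForm_of_ideal {p q r : V3} (h : IsLie (brOf p q r)) (hp : p 2 = 0) (hq : q 2 = 0)
    (hr : r 2 = 0) : HasStdForm (brOf p q r) := by
  obtain ⟨p, rfl⟩ : ∃ p' : Fin 2 → ℂ, p = ![p' 0, p' 1, 0] :=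
    ⟨![p 0, p 1], by apply ext3 <;> simp [hp]⟩
  obtain ⟨q, rfl⟩ : ∃ p' : Fin 2 → ℂ, q = ![p' 0, p' 1, 0] :=
    ⟨![q 0, q 1], by apply ext3 <;> simp [hq]⟩
  obtain ⟨r, rfl⟩ : ∃ p' : Fin 2 → ℂ, r = ![p' 0, p' 1, 0] :=
    ⟨![r 0, r 1], by apply ext3 <;> simp [hr]⟩
  by_cases h0 : p 0 = 0
  · by_cases h1 : p 1 = 0
    · rw [h0, h1]; exact hasStdForm_of_abelian_ideal ..
    · have hi : LieIso (brOf ![p 0, p 1, 0] ![q 0, q 1, 0] ![r 0, r 1, 0])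
          (brOf ![1, 0, 0] ![r 1, -p 1 ^ 2 * r 0, 0] ![-q 1 / p 1 ^ 2, q 0, 0]) := by
        refine lieIso_brOf_of_frame ![0, p 1, 0] ![-(p 1)⁻¹, 0, 0] ![0, 0, 1]
          (by simp [det3, h1]) ?_ ?_ ?_
        all_goals apply ext3 <;> simp [comb, brOf, h0]
        all_goals field_simp
      exact .of_lieIso hi (hasStdForm_of_nonabelian_ideal (h.of_lieIso hi))
  · have hi : LieIso (brOf ![p 0, p 1, 0] ![q 0, q 1, 0] ![r 0, r 1, 0])
        (brOf ![1, 0, 0] ![q 0 + p 1 * r 0 / p 0,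
          p 0 * (p 0 * q 1 + p 1 * r 1 - p 1 * (q 0 + p 1 * r 0 / p 0)), 0]
          ![r 0 / p 0 ^ 2, r 1 - p 1 * r 0 / p 0, 0]) := by
      refine lieIso_brOf_of_frame ![p 0, p 1, 0] ![0, (p 0)⁻¹, 0] ![0, 0, 1]
        (by simp [det3, h0]) ?_ ?_ ?_
      all_goals apply ext3 <;> simp [comb, brOf]
      all_goals field_simp
      all_goals ring
    exact .of_lieIso hi (hasStdForm_of_nonabelian_ideal (h.of_lieIso hi))

theorem IsLie.hasStdForm {b : V3 → V3 → V3} (h : IsLie b) : HasStdForm b := by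
  obtain ⟨p, q, r, rfl⟩ := h.br.exists_brOf h.alt
  by_cases hd : det3 p q r = 0
  · obtain ⟨l, hl, hl'⟩ := (Matrix.exists_mulVec_eq_zero_iff (M := Matrix.of ![p, q, r])).2 (by
      rw [← hd, Matrix.det_fin_three]; simp [det3]; ring)
    have hp := congrFun hl' 0
    have hq := congrFun hl' 1
    have hr := congrFun hl' 2
    simp [Matrix.mulVec, dotProduct, Fin.sum_univ_three] at hp hq hr
    obtain ⟨φ, hφ⟩ := exists_frame_coord hl
    have hi : LieIso (brOf p q r) (transport φ (brOf p q r)) := ⟨φ, rfl⟩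
    have h2 : ∀ x y, transport φ (brOf p q r) x y 2 = 0 := by
      intro x y
      simp only [transport, hφ]
      generalize φ.symm x = x'
      generalize φ.symm y = y'
      simp [brOf]
      linear_combination (x' 0 * y' 1 - x' 1 * y' 0) * hp + (x' 0 * y' 2 - x' 2 * y' 0) * hq
        + (x' 1 * y' 2 - x' 2 * y' 1) * hr
    have h' := h.of_lieIso hi
    refine .of_lieIso hi ?_
    generalize transport φ (brOf p q r) = b' at *
    obtain ⟨p, q, r, rfl⟩ := h'.br.exists_brOf h'.alt
    have hp := h2 (e 0) (e 1)
    have hq := h2 (e 0) (e 2)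
    have hr := h2 (e 1) (e 2)
    simp [brOf, e] at hp hq hr
    exact hasStdForm_of_ideal h' hp hq hr
  · obtain ⟨φ, hφ⟩ := exists_frameEquiv p q r hd
    have h0 := congrFun (h.jac (e 0) (e 1) (e 2)) 0
    have h1 := congrFun (h.jac (e 0) (e 1) (e 2)) 1
    have h2 := congrFun (h.jac (e 0) (e 1) (e 2)) 2
    simp [brOf, e] at h0 h1 h2
    have hx : (![-(r 1 + q 0), p 0 - r 2, p 1 + q 2] : V3) = 0 := by
      rw [← φ.symm.map_eq_zero_iff, hφ]
      apply ext3 <;> simp [comb]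
      · linear_combination h0
      · linear_combination h1
      · linear_combination h2
    have e0 := congrFun hx 0
    have e1 := congrFun hx 1
    have e2 := congrFun hx 2
    simp at e0 e1 e2
    have hp : p = ![r 2, p 1, p 2] := by apply ext3 <;> simp; linear_combination e1
    have hq : q = ![-r 1, - - q 1, - p 1] := by
      apply ext3 <;> simp
      · linear_combination -e0
      · linear_combination e2
    have hr : r = ![r 0, r 1, r 2] := by apply ext3 <;> simp
    refine .of_lieIso ?_ StdBracket.sl2.hasStdForm
    rw [hp, hq]
    nth_rw 3 [hr]
    apply lieIso_bsl2
    intro h0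
    apply hd
    rw [hp, hq]
    simp only [det3]
    simp
    linear_combination h0

lemma TPA.exists_mulOf {m b : V3 → V3 → V3} (h : TPA m b) : ∃ p q r s t u, m = mulOf p q r s t u :=
  h.mul.exists_mulOf h.comm

lemma TPA.compat_coord {m b : V3 → V3 → V3} (h : TPA m b) (k i j c : Fin 3) :
    2 * m (e k) (b (e i) (e j)) c = b (m (e k) (e i)) (e j) c + b (e i) (m (e k) (e j)) c := by
  simpa using congrFun (h.compat (e i) (e j) (e k)) c

lemma classified_bsl2 {m : V3 → V3 → V3} (h : TPA m bsl2) : Classified m bsl2 := by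
  obtain ⟨p, q, r, s, t, u, rfl⟩ := h.exists_mulOf
  have H := fun k => And.intro (h.compat_coord k 0 1) (And.intro (h.compat_coord k 0 2) (h.compat_coord k 1 2))
  simp [Fin.forall_fin_succ, mulOf, bsl2, e] at H
  have : mulOf p q r s t u = fun _ _ => 0 := by
    funext x y
    have hp : p = 0 := by apply ext3 <;> simp <;> grind
    have hq : q = 0 := by apply ext3 <;> simp <;> grind
    have hr : r = 0 := by apply ext3 <;> simp <;> grind
    have hs : s = 0 := by apply ext3 <;> simp <;> grind
    have ht : t = 0 := by apply ext3 <;> simp <;> grind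
    have hu : u = 0 := by apply ext3 <;> simp <;> grind
    apply ext3 <;> simp [mulOf, hp, hq, hr, hs, ht, hu]
  rw [this]
  exact ⟨.t01, trivial, IsoPair.refl _ _⟩

lemma eq_vec3 {x : V3} {a b c : ℂ} (h0 : x 0 = a) (h1 : x 1 = b) (h2 : x 2 = c) : x = ![a, b, c] :=
  ext3 h0 h1 h2

lemma mul_form_bg1 {m : V3 → V3 → V3} (h : TPA m bg1) : ∃ β v w,
    m = mulOf ![0, 0, 0] ![0, 0, 0] ![β, 0, 0] ![0, 0, 0] ![0, β, 0] ![v, w, β] := by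
  obtain ⟨p, q, r, s, t, u, rfl⟩ := h.exists_mulOf
  have H := fun k => And.intro (h.compat_coord k 0 1)
    (And.intro (h.compat_coord k 0 2) (h.compat_coord k 1 2))
  simp [Fin.forall_fin_succ, mulOf, bg1, e] at H
  refine ⟨u 2, u 0, u 1, ?_⟩
  congr 1 <;> apply eq_vec3 <;> grind

lemma mul_form_bg2 {m : V3 → V3 → V3} {α : ℂ} (h : TPA m (bg2 α)) (h0 : α ≠ 0)
    (h1 : 2 * α ≠ 1) : ∃ a b β v w, (α - 2) * a = 0 ∧ (α - 2) * b = 0 ∧ β * b = a * v ∧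
    m = mulOf ![0, a, 0] ![0, 0, 0] ![β, b, 0] ![0, 0, 0] ![0, β, 0] ![v, w, β] := by
  obtain ⟨p, q, r, s, t, u, rfl⟩ := h.exists_mulOf
  have H := fun k => And.intro (h.compat_coord k 0 1)
    (And.intro (h.compat_coord k 0 2) (h.compat_coord k 1 2))
  simp [Fin.forall_fin_succ, mulOf, bg2, e] at H
  have hp : p = ![0, p 1, 0] := by apply eq_vec3 <;> grind
  have hq : q = ![0, 0, 0] := by apply eq_vec3 <;> grind
  have hr : r = ![u 2, r 1, 0] := by apply eq_vec3 <;> grind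
  have hs : s = ![0, 0, 0] := by apply eq_vec3 <;> grind
  have ht : t = ![0, u 2, 0] := by apply eq_vec3 <;> grind
  have A := congrFun (h.assoc (e 0) (e 2) (e 2)) 1
  rw [hp, hq, hr, hs, ht] at A
  simp [mulOf, e] at A
  refine ⟨p 1, r 1, u 2, u 0, u 1, by grind, by grind, by linear_combination A, ?_⟩
  congr 1
  apply eq_vec3 <;> rfl

lemma mul_form_bg2_zero {m : V3 → V3 → V3} (h : TPA m (bg2 0)) :
    ∃ a b β v w, w * a + β * b = b ^ 2 ∧
    m = mulOf ![0, a, 0] ![0, -a, 0] ![β, β - b, 0] ![0, a, 0] ![0, b, 0] ![v, v + w, β] := by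
  obtain ⟨p, q, r, s, t, u, rfl⟩ := h.exists_mulOf
  have H := fun k => And.intro (h.compat_coord k 0 1)
    (And.intro (h.compat_coord k 0 2) (h.compat_coord k 1 2))
  simp [Fin.forall_fin_succ, mulOf, bg2, e] at H
  have hp : p = ![0, s 1, 0] := by apply eq_vec3 <;> grind
  have hq : q = ![0, - s 1, 0] := by apply eq_vec3 <;> grind
  have hr : r = ![u 2, u 2 - t 1, 0] := by apply eq_vec3 <;> grind
  have hs : s = ![0, s 1, 0] := by apply eq_vec3 <;> grind
  have ht : t = ![0, t 1, 0] := by apply eq_vec3 <;> grind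
  have A := congrFun (h.assoc (e 1) (e 2) (e 2)) 1
  rw [hp, hq, hr, hs, ht] at A
  simp [mulOf, e] at A
  refine ⟨s 1, t 1, u 2, u 0, u 1 - u 0, by linear_combination -A, ?_⟩
  congr 1
  apply eq_vec3 <;> ring

lemma isoPair_of_eq {m b m' b' : V3 → V3 → V3} (hm : m = m') (hb : b = b') :
    IsoPair m b m' b' := by
  subst hm hb; exact .refl _ _

lemma classified_bg1 {m : V3 → V3 → V3} (h : TPA m bg1) : Classified m bg1 := by
  obtain ⟨β, v, w, rfl⟩ := mul_form_bg1 h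
  by_cases hβ : β = 0
  · subst hβ
    by_cases hv : v = 0
    · by_cases hw : w = 0
      · refine ⟨.t07 0, trivial, isoPair_of_eq ?_ rfl⟩
        funext x y; apply ext3 <;> simp [tMul, mT07, mulOf, hv, hw]
      · refine ⟨.t08, trivial, isoPair_of_frame ![v, w, 0] ![1, 0, 0] ![0, 0, 1]
          (by simp [det3, hw]) ?_ ?_⟩ <;> intro x y <;>
          apply ext3 <;> simp [comb, tMul, tBr, mT08, mulOf, bg1] <;> ring
    · refine ⟨.t08, trivial, isoPair_of_frame ![v, w, 0] ![0, 1, 0] ![0, 0, 1]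
        (by simp [det3, hv]) ?_ ?_⟩ <;> intro x y <;>
        apply ext3 <;> simp [comb, tMul, tBr, mT08, mulOf, bg1] <;> ring
  · refine ⟨.t07 β, trivial, isoPair_of_frame ![1, 0, 0] ![0, 1, 0] ![-v / β, -w / β, 1]
      (by simp [det3]) ?_ ?_⟩ <;> intro x y <;>
      apply ext3 <;> simp [comb, tMul, tBr, mT07, mulOf, bg1] <;> field_simp <;> ring

lemma isoPair_bg2_of_frame {m μ : V3 → V3 → V3} (α s q x y : ℂ) (hs : s ≠ 0) (hq : q ≠ 0) (t : ℂ)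
    (ht : s + t * (α - 1) = q)
    (h : ∀ X Y, comb ![s, t, 0] ![0, q, 0] ![x, y, 1] (μ X Y) =
      m (comb ![s, t, 0] ![0, q, 0] ![x, y, 1] X) (comb ![s, t, 0] ![0, q, 0] ![x, y, 1] Y)) :
    IsoPair m (bg2 α) μ (bg2 α) := by
  refine isoPair_of_frame _ _ _ (by simp [det3, hs, hq]) h ?_
  subst ht
  intro x y
  apply ext3 <;> simp [comb, bg2] <;> ring

lemma classified_bg2_of_nilpotent (α v w : ℂ) (h0 : α ≠ 0) :
    Classified (mulOf ![0, 0, 0] ![0, 0, 0] ![0, 0, 0] ![0, 0, 0] ![0, 0, 0] ![v, w, 0])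
      (bg2 α) := by
  by_cases hv : v = 0
  · by_cases hw : w = 0
    · refine ⟨.t09 α 0, trivial, isoPair_of_eq ?_ rfl⟩
      funext x y; apply ext3 <;> simp [tMul, mT09, mulOf, hv, hw]
    · refine ⟨.t10 α, trivial, isoPair_bg2_of_frame α w w 0 0 hw hw 0 (by simp) ?_⟩
      intro X Y; apply ext3 <;> simp [tMul, comb, mT10, mulOf, hv]
  · by_cases hq : v + w * (α - 1) = 0
    · have hw : w ≠ 0 := by rintro rfl; simp at hq; exact hv hq
      refine ⟨.t10 α⁻¹, trivial, isoPair_of_frame ![w / α, 0, 0] ![v / α ^ 2, w / α ^ 2, 0]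
        ![0, 0, α⁻¹] (by simp [det3, h0, hw]) ?_ ?_⟩ <;> obtain rfl : v = w * (1 - α) := by
          linear_combination hq
      all_goals intro X Y; apply ext3 <;> simp [tMul, tBr, comb, mT10, mulOf, bg2]
      all_goals field_simp
      all_goals ring
    · refine ⟨.t11 α, trivial, isoPair_bg2_of_frame α v _ 0 0 hv hq w rfl ?_⟩
      intro X Y; apply ext3 <;> simp [tMul, comb, mT11, mulOf]

lemma classified_bg2 {m : V3 → V3 → V3} {α : ℂ} (h : TPA m (bg2 α)) (h0 : α ≠ 0)
    (h1 : 2 * α ≠ 1) : Classified m (bg2 α) := by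
  obtain ⟨a, b, β, v, w, ha, hb, hr, rfl⟩ := mul_form_bg2 h h0 h1
  clear h
  by_cases hab : a = 0 ∧ b = 0
  · obtain ⟨rfl, rfl⟩ := hab
    by_cases hβ : β = 0
    · subst hβ; exact classified_bg2_of_nilpotent α v w h0
    · refine ⟨.t09 α β, trivial, isoPair_bg2_of_frame α 1 1 (-v / β) (-w / β) one_ne_zero
        one_ne_zero 0 (by simp) ?_⟩
      intro X Y; apply ext3 <;> simp [tMul, comb, mT09, mulOf] <;> field_simp <;> ring
  obtain rfl : α = 2 := by
    by_contra hα
    exact hab ⟨(mul_eq_zero.1 ha).resolve_left (sub_ne_zero.2 hα),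
      (mul_eq_zero.1 hb).resolve_left (sub_ne_zero.2 hα)⟩
  clear ha hb h0 h1
  by_cases ha : a = 0
  · subst ha
    have hb : b ≠ 0 := fun hb => hab ⟨rfl, hb⟩
    obtain rfl : β = 0 := by simpa [hb] using hr
    clear hab hr
    by_cases hv : v = 0
    · refine ⟨.t15, trivial, isoPair_bg2_of_frame 2 1 b (-w / (2 * b)) 0 one_ne_zero hb (b - 1)
        (by ring) ?_⟩
      intro X Y; apply ext3 <;> simp [tMul, comb, mT15, mulOf, hv]; field_simp; ring
    · refine ⟨.t14, trivial, isoPair_bg2_of_frame 2 v (v * b) ((v * b - v - w) / (2 * b)) 0 hv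
        (by simp [hv, hb]) (v * b - v) (by ring) ?_⟩
      intro X Y; apply ext3 <;> simp [tMul, comb, mT14, mulOf]; ring_nf
      field_simp; ring
  · clear hab
    by_cases hβ : β = 0
    · subst hβ
      obtain rfl : v = 0 := by simpa [ha, eq_comm] using hr
      by_cases hw : w * a = b ^ 2
      · obtain rfl : w = b ^ 2 / a := by field_simp; exact hw
        refine ⟨.t12 0, trivial, isoPair_bg2_of_frame 2 1 a (-b / a) 0 one_ne_zero ha (a - 1)
          (by ring) ?_⟩
        intro X Y; apply ext3 <;> simp [tMul, comb, mT12, mulOf]; field_simp; ring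
      · obtain ⟨s, hs⟩ := IsAlgClosed.exists_pow_nat_eq ((w - b ^ 2 / a) / a) (n := 2)
          (by norm_num)
        have hq : a * s ^ 2 ≠ 0 := by
          rw [hs, mul_div_cancel₀ _ ha, sub_ne_zero, ne_eq, eq_div_iff ha]; exact hw
        obtain rfl : w = a * s ^ 2 + b ^ 2 / a := by rw [hs]; field_simp; ring
        have hs0 : s ≠ 0 := by rintro rfl; simp at hq
        refine ⟨.t13, trivial, isoPair_bg2_of_frame 2 s (a * s ^ 2) (-b / a) 0 hs0 hq
          (a * s ^ 2 - s) (by ring) ?_⟩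
        intro X Y; apply ext3 <;> simp [tMul, comb, mT13, mulOf]; field_simp; ring
    · obtain rfl : b = a * v / β := by field_simp; linear_combination hr
      refine ⟨.t12 β, trivial, isoPair_bg2_of_frame 2 1 a (-v / β)
        ((a * v ^ 2 / β ^ 2 - w) / β) one_ne_zero ha (a - 1) (by ring) ?_⟩
      intro X Y; apply ext3 <;> simp [tMul, comb, mT12, mulOf] <;> field_simp <;> ring

lemma classified_bg2_zero {m : V3 → V3 → V3} (h : TPA m (bg2 0)) : Classified m (bg2 0) := by
  obtain ⟨a, b, β, v, w, hr, rfl⟩ := mul_form_bg2_zero h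
  clear h
  by_cases ha : a = 0
  · subst ha
    by_cases hβ : β = 0
    · subst hβ
      obtain rfl : b = 0 := by simpa using hr.symm
      by_cases hv : v = 0
      · by_cases hw : w = 0
        · refine ⟨.t09 0 0, trivial, isoPair_of_eq ?_ rfl⟩
          funext x y; apply ext3 <;> simp [tMul, mT09, mulOf, hv, hw]
        · refine ⟨.t10 0, trivial, isoPair_bg2_of_frame 0 1 w 0 0 one_ne_zero hw (1 - w)
            (by ring) ?_⟩
          intro X Y; apply ext3 <;> simp [tMul, comb, mT10, mulOf, hv]
      · by_cases hw : w = 0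
        · refine ⟨.t16, trivial, isoPair_bg2_of_frame 0 v 1 0 0 hv one_ne_zero (v - 1)
            (by ring) ?_⟩
          intro X Y; apply ext3 <;> simp [tMul, comb, mT16, mulOf, hw] <;> ring
        · refine ⟨.t11 0, trivial, isoPair_bg2_of_frame 0 v (-w) 0 0 hv (neg_ne_zero.2 hw) (v + w)
            (by ring) ?_⟩
          intro X Y; apply ext3 <;> simp [tMul, comb, mT11, mulOf]
    · by_cases hb : b = 0
      · subst hb
        refine ⟨.t19 β, hβ, isoPair_bg2_of_frame 0 1 1 (-v / β) (-v / β + w / β) one_ne_zero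
          one_ne_zero 0 (by ring) ?_⟩
        intro X Y; apply ext3 <;> simp [tMul, comb, mT19, mulOf] <;> field_simp <;> ring
      · obtain rfl : b = β := mul_left_cancel₀ hb (by linear_combination -hr)
        refine ⟨.t09 0 b, trivial, isoPair_bg2_of_frame 0 1 1 (-v / b) (-v / b - w / b) one_ne_zero
          one_ne_zero 0 (by ring) ?_⟩
        intro X Y; apply ext3 <;> simp [tMul, comb, mT09, mulOf] <;> field_simp <;> ring
  · obtain rfl : w = (b ^ 2 - β * b) / a := by field_simp; linear_combination hr
    have ha' : 1 / a ≠ 0 := by simp [ha]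
    by_cases hβ : β = 0
    · subst hβ
      by_cases hv : v = 0
      · refine ⟨.t17 0, trivial, isoPair_bg2_of_frame 0 1 (1 / a) 0 (-b / a) one_ne_zero
          ha' (1 - 1 / a) (by ring) ?_⟩
        intro X Y; apply ext3 <;> simp [tMul, comb, mT17, mulOf, hv]; field_simp; ring
      · refine ⟨.t18, trivial, isoPair_bg2_of_frame 0 v (1 / a) 0 (-b / a) hv
          ha' (v - 1 / a) (by ring) ?_⟩
        intro X Y; apply ext3 <;> simp [tMul, comb, mT18, mulOf] <;> field_simp <;> ring
    · refine ⟨.t17 β, trivial, isoPair_bg2_of_frame 0 1 (1 / a) (-v / β) (-v / β + (β - b) / a)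
        one_ne_zero ha' (1 - 1 / a) (by ring) ?_⟩
      intro X Y; apply ext3 <;> simp [tMul, comb, mT17, mulOf] <;> field_simp <;> ring

lemma TPA.of_isoPair {m b m' b' : V3 → V3 → V3} (h : TPA m b) (hi : IsoPair m b m' b') :
    TPA m' b' := by
  obtain ⟨φ, h1, h2⟩ := hi
  have hm : m' = _root_.transport φ m := by funext x y; simp [_root_.transport, h1]
  have hb : b' = _root_.transport φ b := by funext x y; simp [_root_.transport, h2]
  rw [hm, hb]; exact h.transport φ

lemma TPA.assoc_coord {m b : V3 → V3 → V3} (h : TPA m b) (i j k c : Fin 3) :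
    m (m (e i) (e j)) (e k) c = m (e i) (m (e j) (e k)) c :=
  congrFun (h.assoc (e i) (e j) (e k)) c

lemma mul_form_bh {m : V3 → V3 → V3} (h : TPA m bh) : ∃ a b x c d y f g z,
    m = mulOf ![a, b, x] ![c, d, y] ![0, 0, (a + d) / 2] ![f, g, z] ![0, 0, (c + g) / 2]
      ![0, 0, 0] := by
  obtain ⟨p, q, r, s, t, u, rfl⟩ := h.exists_mulOf
  have H := fun k => And.intro (h.compat_coord k 0 1)
    (And.intro (h.compat_coord k 0 2) (h.compat_coord k 1 2))
  simp [Fin.forall_fin_succ, mulOf, bh, e] at H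
  refine ⟨p 0, p 1, p 2, q 0, q 1, q 2, s 0, s 1, s 2, ?_⟩
  congr 1 <;> apply eq_vec3 <;> grind

lemma isoPair_bh_of_frame {m μ : V3 → V3 → V3} (u v : Fin 2 → ℂ) (x y w : ℂ)
    (hw : u 0 * v 1 - u 1 * v 0 = w) (hw0 : w ≠ 0)
    (h : ∀ X Y, comb ![u 0, u 1, x] ![v 0, v 1, y] ![0, 0, w] (μ X Y) =
      m (comb ![u 0, u 1, x] ![v 0, v 1, y] ![0, 0, w] X)
        (comb ![u 0, u 1, x] ![v 0, v 1, y] ![0, 0, w] Y)) :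
    IsoPair m bh μ bh := by
  refine isoPair_of_frame _ _ _ ?_ h ?_
  · have : det3 ![u 0, u 1, x] ![v 0, v 1, y] ![0, 0, w] = w * w := by
      nth_rw 2 [← hw]; simp [det3]; ring
    rw [this]; exact mul_ne_zero hw0 hw0
  · subst hw
    intro X Y
    apply ext3 <;> simp [comb, bh] ; ring

lemma classified_bh_of_unital {m : V3 → V3 → V3} (h : TPA m bh)
    (h2 : ∀ X, m X (e 2) = X 1 • e 2) : Classified m bh := by
  obtain ⟨a, b, x, c, d, y, f, g, z, rfl⟩ := mul_form_bh h
  have A := congrFun (h2 (e 0)) 2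
  have B := congrFun (h2 (e 1)) 2
  have C := h.assoc_coord 0 0 2 2
  have D := h.assoc_coord 0 1 2 2
  have E := h.assoc_coord 1 1 2 2
  simp [mulOf, e] at A B C D E
  have hb : b = 0 := by grind
  have hd : d = 0 := by grind
  have ha : a = 0 := by grind
  have hg : g = 1 := by grind
  have hc : c = 1 := by grind
  subst hb hd ha hg hc
  have F := h.assoc_coord 1 1 0 2
  simp [mulOf, e] at F
  obtain rfl : y = f * x := by linear_combination -F
  by_cases hx : x = 0
  · subst hx
    refine ⟨.t06, trivial, isoPair_bh_of_frame ![1, 0] ![-f, 1] 0 (-z) 1 (by simp) one_ne_zero ?_⟩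
    intro X Y; apply ext3 <;> simp [tMul, comb, mT06, mulOf] <;> ring
  · refine ⟨.t05, trivial, isoPair_bh_of_frame ![1 / x, 0] ![-f, 1] 0 (f ^ 2 * x - z) (1 / x)
      (by simp) (by simp [hx]) ?_⟩
    intro X Y; apply ext3 <;> simp [tMul, comb, mT05, mulOf] <;> field_simp <;> ring

lemma classified_bh_of_nilpotent {x y f z : ℂ} (h : TPA (mulOf ![0, 0, x] ![0, 0, y] ![0, 0, 0]
    ![f, 0, z] ![0, 0, 0] ![0, 0, 0]) bh) :
    Classified (mulOf ![0, 0, x] ![0, 0, y] ![0, 0, 0] ![f, 0, z] ![0, 0, 0] ![0, 0, 0]) bh := by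
  by_cases hf : f = 0
  · subst hf
    clear h
    by_cases hx : x = 0
    · subst hx
      by_cases hy : y = 0
      · subst hy
        by_cases hz : z = 0
        · refine ⟨.t03 0, trivial, isoPair_of_eq ?_ rfl⟩
          funext X Y; apply ext3 <;> simp [tMul, mT03, mulOf, hz]
        · refine ⟨.t02, trivial, isoPair_bh_of_frame ![z, 0] ![0, 1] 0 0 z (by simp) hz ?_⟩
          intro X Y; apply ext3 <;> simp [tMul, comb, mT02, mulOf]
      · refine ⟨.t03 y, trivial, isoPair_bh_of_frame ![1, 0] ![-z / (2 * y), 1] 0 0 1 (by simp)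
          one_ne_zero ?_⟩
        intro X Y; apply ext3 <;> simp [tMul, comb, mT03, mulOf]; field_simp; ring
    · by_cases hΔ : y ^ 2 = x * z
      · obtain rfl : z = y ^ 2 / x := by field_simp; linear_combination -hΔ
        refine ⟨.t02, trivial, isoPair_bh_of_frame ![y, -x] ![1, 0] 0 0 x (by simp) hx ?_⟩
        intro X Y; apply ext3 <;> simp [tMul, comb, mT02, mulOf]; field_simp; ring
      · obtain ⟨δ, hδ⟩ := IsAlgClosed.exists_pow_nat_eq (y ^ 2 - x * z) (n := 2) (by norm_num)
        have hδ0 : δ ≠ 0 := by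
          rintro rfl; apply hΔ; linear_combination -hδ
        obtain rfl : z = (y ^ 2 - δ ^ 2) / x := by field_simp; linear_combination hδ
        refine ⟨.t03 (-δ), trivial, isoPair_bh_of_frame ![-y + δ, x] ![-y - δ, x] 0 0 (2 * δ * x)
          (by simp; ring) (by simp [hδ0, hx]) ?_⟩
        intro X Y; apply ext3 <;> simp [tMul, comb, mT03, mulOf]; field_simp; ring
  · have A := h.assoc_coord 1 1 0 2
    simp [mulOf, e, hf] at A
    subst A
    refine ⟨.t04 y, trivial, isoPair_bh_of_frame ![f, 0] ![0, 1] z 0 f (by simp) hf ?_⟩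
    intro X Y; apply ext3 <;> simp [tMul, comb, mT04, mulOf] ; ring

lemma classified_bh_of_character {m : V3 → V3 → V3} (h : TPA m bh) {P R : ℂ}
    (h2 : ∀ X, m X (e 2) = (P * X 0 + R * X 1) • e 2) (u v : Fin 2 → ℂ)
    (hdet : u 0 * v 1 - u 1 * v 0 = 1) (hu : P * u 0 + R * u 1 = 0) (hv : P * v 0 + R * v 1 = 1) :
    Classified m bh := by
  obtain ⟨φ, hφ⟩ := exists_frameEquiv ![u 0, u 1, 0] ![v 0, v 1, 0] ![0, 0, 1]
    (by simp [det3, hdet])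
  have hbr : transport φ bh = bh := by
    funext X Y
    rw [transport, ← LinearEquiv.eq_symm_apply, hφ, hφ, hφ]
    apply ext3 <;> simp [comb, bh]
    linear_combination (X 0 * Y 1 - X 1 * Y 0) * hdet
  have hi := isoPair_transport φ m bh
  rw [hbr] at hi
  have he : φ.symm (e 2) = e 2 := by
    rw [hφ]; apply ext3 <;> simp [comb, e]
  refine .of_iso hi (classified_bh_of_unital (h.of_isoPair hi) fun X => ?_)
  rw [transport, he, h2, map_smul, (LinearEquiv.eq_symm_apply φ).1 he.symm, hφ]
  congr 1
  simp [comb]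
  linear_combination X 0 * hu + X 1 * hv

lemma classified_bh {m : V3 → V3 → V3} (h : TPA m bh) : Classified m bh := by
  obtain ⟨a, b, x, c, d, y, f, g, z, hm⟩ := mul_form_bh h
  set P := (a + d) / 2 with hP
  set R := (c + g) / 2 with hR
  have hχ : ∀ X, m X (e 2) = (P * X 0 + R * X 1) • e 2 := by
    intro X; rw [hm]; apply ext3 <;> simp [mulOf, e]
    ring
  by_cases hP0 : P = 0
  · by_cases hR0 : R = 0
    · rw [hP0, hR0] at hm
      obtain rfl : d = -a := by linear_combination 2 * hP0
      obtain rfl : g = -c := by linear_combination 2 * hR0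
      clear_value P R
      clear hP hR hP0 hR0
      subst hm
      have A := h.assoc_coord 0 0 1 0
      have B := h.assoc_coord 0 0 1 1
      have C := h.assoc_coord 1 1 0 0
      simp [mulOf, e] at A B C
      by_cases hb : b = 0
      · subst hb
        have ha : a = 0 := by grind
        subst ha
        have hc : c = 0 := by grind
        subst hc
        simp only [neg_zero] at h ⊢
        exact classified_bh_of_nilpotent h
      · have hi : IsoPair (mulOf ![a, b, x] ![c, -a, y] ![0, 0, 0] ![f, -c, z] ![0, 0, 0] ![0, 0, 0])
            bh (mulOf ![0, 0, (a ^ 2 * x + 2 * a * b * y + b ^ 2 * z) / -b]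
              ![0, 0, (a * x + b * y) / -b] ![0, 0, 0] ![1, 0, x / -b] ![0, 0, 0] ![0, 0, 0]) bh := by
          obtain rfl : c = -a ^ 2 / b := by field_simp; grind
          obtain rfl : f = a ^ 3 / b ^ 2 := by field_simp; field_simp at A; grind
          refine isoPair_bh_of_frame ![a, b] ![1, 0] 0 0 (-b) (by simp) (by simp [hb]) ?_
          intro X Y; apply ext3 <;> simp [comb, mulOf] <;> field_simp <;> ring
        exact .of_iso hi (classified_bh_of_nilpotent (h.of_isoPair hi))
    · refine classified_bh_of_character h hχ ![R, 0] ![0, 1 / R] ?_ ?_ ?_ <;> simp [hR0, hP0]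
  · refine classified_bh_of_character h hχ ![R, -P] ![1 / P, 0] ?_ ?_ ?_ <;> simp [hP0]
    ring

lemma exists_common_eigenvector {ι V : Type*} [AddCommGroup V] [Module ℂ V]
    [FiniteDimensional ℂ V] [Nontrivial V] (f : ι → Module.End ℂ V)
    (hf : ∀ i j, Commute (f i) (f j)) : ∃ v ≠ 0, ∀ i, ∃ c : ℂ, f i v = c • v := by
  obtain ⟨W, ⟨hW0, hW⟩, hmin⟩ := WellFounded.has_min (r := ((· < ·) : Submodule ℂ V → _ → Prop))
    wellFounded_lt {W | W ≠ ⊥ ∧ ∀ i, ∀ x ∈ W, f i x ∈ W} ⟨⊤, by simp⟩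
  obtain ⟨v, hvW, hv⟩ := W.ne_bot_iff.1 hW0
  refine ⟨v, hv, fun i => ?_⟩
  have : Nontrivial W := Submodule.nontrivial_iff_ne_bot.2 hW0
  obtain ⟨c, hc⟩ := Module.End.exists_eigenvalue ((f i).restrict (hW i))
  obtain ⟨w, hw⟩ := hc.exists_hasEigenvector
  have hle : W ⊓ (f i).eigenspace c = W := by
    by_contra hne
    refine hmin _ ⟨?_, fun j x hx => Submodule.mem_inf.2 ⟨hW j x hx.1, ?_⟩⟩ (lt_of_le_of_ne inf_le_left hne)
    · refine (Submodule.ne_bot_iff _).2 ⟨w, ⟨w.2, ?_⟩, by simpa using hw.2⟩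
      exact Module.End.mem_eigenspace_iff.2 (congrArg Subtype.val hw.apply_eq_smul)
    · have hx' := Module.End.mem_eigenspace_iff.1 hx.2
      refine Module.End.mem_eigenspace_iff.2 ?_
      have := LinearMap.congr_fun (hf i j).eq x
      simp only [Module.End.mul_apply] at this
      rw [this, hx', map_smul]
  exact ⟨c, Module.End.mem_eigenspace_iff.1 (hle.ge hvW).2⟩

lemma TPA.exists_character {m b : V3 → V3 → V3} (h : TPA m b) :
    ∃ ℓ : V3 →ₗ[ℂ] ℂ, ℓ ≠ 0 ∧ ∃ c : V3 → ℂ, ∀ z x, ℓ (m z x) = c z * ℓ x := by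
  let L : V3 → V3 →ₗ[ℂ] V3 := fun z =>
    { toFun := m z
      map_add' := fun x y => by simpa using h.mul.2 1 z x y
      map_smul' := fun a x => by simpa [h.mul.map_zero_right] using h.mul.2 a z x 0 }
  obtain ⟨ℓ, hℓ, hc⟩ := exists_common_eigenvector (V := Module.Dual ℂ V3)
    (fun z => (L z).dualMap) fun z w => by
      refine LinearMap.ext fun ℓ => LinearMap.ext fun x => ?_
      change ℓ (m w (m z x)) = ℓ (m z (m w x))
      rw [← h.assoc, h.comm w z, h.assoc]
  choose c hc using hc
  exact ⟨ℓ, hℓ, c, fun z x => LinearMap.congr_fun (hc z) x⟩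

lemma exists_frame_coord_one {l : Fin 2 → ℂ} (hl : l ≠ 0) :
    ∃ φ : V3 ≃ₗ[ℂ] V3, ∀ x, φ x 1 = l 0 * x 0 + l 1 * x 1 ∧ φ x 2 = x 2 := by
  have key : ∀ u v w, det3 u v w ≠ 0 → (∀ x, x 1 = l 0 * comb u v w x 0 + l 1 * comb u v w x 1) →
      (∀ x, x 2 = comb u v w x 2) →
      ∃ φ : V3 ≃ₗ[ℂ] V3, ∀ x, φ x 1 = l 0 * x 0 + l 1 * x 1 ∧ φ x 2 = x 2 := by
    intro u v w hd h1 h2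
    obtain ⟨φ, hφ⟩ := exists_frameEquiv u v w hd
    refine ⟨φ, fun x => ?_⟩
    have h1 := h1 (φ x)
    have h2 := h2 (φ x)
    rw [← hφ, LinearEquiv.symm_apply_apply] at h1 h2
    exact ⟨h1, h2⟩
  by_cases h1 : l 1 = 0
  · have h0 : l 0 ≠ 0 := fun h0 => hl (by ext i; fin_cases i <;> assumption)
    refine key ![0, 1, 0] ![1 / l 0, 0, 0] ![0, 0, 1] (by simp [det3, h0]) ?_ ?_ <;> intro x <;>
      simp [comb, h1]
    field_simp
  · refine key ![l 1, -l 0, 0] ![0, 1 / l 1, 0] ![0, 0, 1] (by simp [det3, h1]) ?_ ?_ <;>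
      intro x <;> simp [comb]
    field_simp; ring

lemma TPA.exists_triangular {m : V3 → V3 → V3} (h : TPA m fun _ _ => 0) :
    ∃ n l g k f c h d b a, IsoPair m (fun _ _ => 0)
      (mulOf ![n, 0, 0] ![l, 0, 0] ![g, 0, 0] ![k, h, 0] ![f, d, 0] ![c, b, a]) fun _ _ => 0 := by
  have htr : ∀ φ : V3 ≃ₗ[ℂ] V3, _root_.transport φ (fun _ _ => 0) = fun _ _ => 0 := fun φ => by
    funext x y; simp [_root_.transport]
  obtain ⟨ℓ, hℓ, χ, hχ⟩ := h.exists_character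
  obtain ⟨φ, hφ⟩ := exists_frame_coord (l := fun i => ℓ (e i)) fun h0 => hℓ <| by
    refine LinearMap.ext fun x => ?_
    rw [eq_sum_e x]; simp [show ∀ i, ℓ (e i) = 0 from congrFun h0]
  have hφ' : ∀ x, φ x 2 = ℓ x := by
    intro x
    rw [hφ]; conv_rhs => rw [eq_sum_e x]
    simp; ring
  have hT := h.transport φ
  have hi := isoPair_transport φ m fun _ _ => 0
  rw [htr] at hT hi
  have hm2 : ∀ x y, _root_.transport φ m x y 2 = χ (φ.symm x) * y 2 := by
    intro x y
    rw [_root_.transport, hφ', hχ, ← hφ', LinearEquiv.apply_symm_apply]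
  generalize _root_.transport φ m = m' at hT hi hm2
  obtain ⟨a, ha⟩ : ∃ a, ∀ x y, m' x y 2 = a * x 2 * y 2 := by
    refine ⟨χ (φ.symm (e 2)), fun x y => ?_⟩
    have h1 : m' x (e 2) 2 = χ (φ.symm (e 2)) * x 2 := by rw [hT.comm, hm2]
    have h2 := hm2 x (e 2)
    rw [hm2, ← h1, h2]; simp [e]
  let N : V3 → Matrix (Fin 2) (Fin 2) ℂ := fun z =>
    !![m' z (e 0) 0, m' z (e 0) 1; m' z (e 1) 0, m' z (e 1) 1]
  have hexp : ∀ z x, x 2 = 0 → m' z x = x 0 • m' z (e 0) + x 1 • m' z (e 1) := by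
    intro z x hx
    conv_lhs => rw [eq_sum_e x, hT.mul.2, hT.mul.2, hT.mul.2, hx, hT.mul.map_zero_right]
    simp
  have hN : ∀ z w, Commute (N z) (N w) := by
    intro z w
    have hcomm : ∀ x, m' z (m' w x) = m' w (m' z x) := fun x => by
      rw [← hT.assoc, hT.comm z w, hT.assoc]
    have h0 := hcomm (e 0)
    have h1 := hcomm (e 1)
    rw [hexp z _ (by rw [ha]; simp [e]), hexp w (m' z _) (by rw [ha]; simp [e])] at h0 h1
    have h00 := congrFun h0 0
    have h01 := congrFun h0 1
    have h10 := congrFun h1 0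
    have h11 := congrFun h1 1
    simp only [Pi.add_apply, Pi.smul_apply, smul_eq_mul] at h00 h01 h10 h11
    ext i j
    fin_cases i <;> fin_cases j <;> simp [N, Matrix.mul_apply, Fin.sum_univ_two]
    · linear_combination -h00
    · linear_combination -h01
    · linear_combination -h10
    · linear_combination -h11
  obtain ⟨l, hl, hc⟩ := exists_common_eigenvector (fun z => Matrix.toLin' (N z)) fun z w => by
    rw [Commute, SemiconjBy, Module.End.mul_eq_comp, Module.End.mul_eq_comp, ← Matrix.toLin'_mul,
      ← Matrix.toLin'_mul, (hN z w).eq]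
  choose c hc using hc
  have hc' : ∀ z x, x 2 = 0 → l 0 * m' z x 0 + l 1 * m' z x 1 = c z * (l 0 * x 0 + l 1 * x 1) := by
    intro z x hx
    have h0 := congrFun (hc z) 0
    have h1 := congrFun (hc z) 1
    simp [N, Matrix.mulVec, dotProduct, Fin.sum_univ_two] at h0 h1
    rw [hexp z x hx]
    simp
    linear_combination x 0 * h0 + x 1 * h1
  obtain ⟨ψ, hψ⟩ := exists_frame_coord_one hl
  have hi' := isoPair_transport ψ m' fun _ _ => 0
  rw [htr] at hi'
  have hT' := hT.of_isoPair hi'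
  have hm1 : ∀ x y, y 2 = 0 → _root_.transport ψ m' x y 1 = c (ψ.symm x) * y 1 := by
    intro x y hy
    rw [_root_.transport, (hψ _).1, hc', ← (hψ _).1, LinearEquiv.apply_symm_apply]
    rw [← (hψ (ψ.symm y)).2, LinearEquiv.apply_symm_apply, hy]
  have hm2' : ∀ x y, _root_.transport ψ m' x y 2 = a * x 2 * y 2 := by
    intro x y
    rw [_root_.transport, (hψ _).2, ha, ← (hψ (ψ.symm x)).2, ← (hψ (ψ.symm y)).2]
    simp
  generalize _root_.transport ψ m' = m'' at hi' hT' hm1 hm2'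
  obtain ⟨p, q, r, s, t, u, rfl⟩ := hT'.exists_mulOf
  have A := hm1 (e 0) (e 0)
  have B := hm1 (e 1) (e 0)
  have C := hm1 (e 2) (e 0)
  have D := hm2' (e 0) (e 0)
  have E := hm2' (e 0) (e 1)
  have F := hm2' (e 0) (e 2)
  have G := hm2' (e 1) (e 1)
  have H := hm2' (e 1) (e 2)
  simp [mulOf, e] at A B C D E F G H
  refine ⟨p 0, q 0, r 0, s 0, t 0, u 0, s 1, t 1, u 1, u 2, ?_⟩
  convert hi.trans hi' using 2 <;> apply ext3 <;> simp [*]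

lemma isoPair_zero_of_frame {m μ : V3 → V3 → V3} (u v w : V3) (h : det3 u v w ≠ 0)
    (h1 : ∀ x y, comb u v w (μ x y) = m (comb u v w x) (comb u v w y)) :
    IsoPair m (fun _ _ => 0) μ fun _ _ => 0 :=
  isoPair_of_frame u v w h h1 fun x y => by apply ext3 <;> simp [comb]

lemma triangular_relations {n l g k f c h d b a : ℂ} (H : TPA (mulOf ![n, 0, 0] ![l, 0, 0]
      ![g, 0, 0] ![k, h, 0] ![f, d, 0] ![c, b, a]) fun _ _ => 0) :
    k * n + h * l = l ^ 2 ∧ f * n + d * l = l * g ∧ c * n + b * l + a * g = g ^ 2 ∧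
      b * h + a * d = d ^ 2 ∧ k * g + h * f = f * l + d * k ∧
      f * g + d * f = c * l + b * k + a * f := by
  have A := H.assoc_coord 0 1 1 0
  have B := H.assoc_coord 0 1 2 0
  have C := H.assoc_coord 0 2 2 0
  have D := H.assoc_coord 1 2 2 1
  have E := H.assoc_coord 1 1 2 0
  have F := H.assoc_coord 1 2 2 0
  simp [mulOf, e] at A B C D E F
  refine ⟨?_, ?_, ?_, ?_, ?_, ?_⟩ <;> grind

lemma classified_of_split {h d b a : ℂ} (hd : b * h + a * d = d ^ 2) :
    Classified (mulOf ![1, 0, 0] ![0, 0, 0] ![0, 0, 0] ![0, h, 0] ![0, d, 0] ![0, b, a])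
      fun _ _ => 0 := by
  by_cases hh : h = 0
  · subst hh
    by_cases hd0 : d = 0
    · subst hd0
      by_cases ha : a = 0
      · subst ha
        by_cases hb : b = 0
        · subst hb
          refine ⟨.t27, trivial, isoPair_of_eq ?_ rfl⟩
          funext X Y; apply ext3 <;> simp [tMul, mT27, mulOf]
        · refine ⟨.t26, trivial, isoPair_zero_of_frame ![1, 0, 0] ![0, 0, 1] ![0, b, 0]
            (by simp [det3, hb]) ?_⟩
          intro X Y; apply ext3 <;> simp [tMul, comb, mT26, mulOf]
      · refine ⟨.t22, trivial, isoPair_zero_of_frame ![1, 0, 0] ![0, b / a ^ 2, 1 / a] ![0, 1, 0]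
          (by simp [det3, ha]) ?_⟩
        intro X Y; apply ext3 <;> simp [tMul, comb, mT22, mulOf] <;> field_simp
    · obtain rfl : a = d := by grind
      refine ⟨.t21, trivial, isoPair_zero_of_frame ![0, -b / a ^ 2, 1 / a] ![1, 0, 0] ![0, 1, 0]
        (by simp [det3, hd0]) ?_⟩
      intro X Y; apply ext3 <;> simp [tMul, comb, mT21, mulOf] <;> field_simp <;> ring
  · obtain rfl : b = (d ^ 2 - a * d) / h := by field_simp; linear_combination hd
    by_cases ha : a = 0
    · subst ha
      refine ⟨.t22, trivial, isoPair_zero_of_frame ![1, 0, 0] ![0, 1 / h, 0] ![0, -d / h, 1]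
        (by simp [det3, hh]) ?_⟩
      intro X Y; apply ext3 <;> simp [tMul, comb, mT22, mulOf] <;> field_simp <;> ring
    · refine ⟨.t20, trivial, isoPair_zero_of_frame ![1, 0, 0] ![0, 1 / h, 0]
        ![0, -d / (h * a), 1 / a] (by simp [det3, hh, ha]) ?_⟩
      intro X Y; apply ext3 <;> simp [tMul, comb, mT20, mulOf] <;> field_simp <;> ring

lemma classified_triangular_of_ne {n l g k f c h d b a : ℂ} (hn : n ≠ 0) (H : TPA (mulOf ![n, 0, 0]
      ![l, 0, 0] ![g, 0, 0] ![k, h, 0] ![f, d, 0] ![c, b, a]) fun _ _ => 0) :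
    Classified (mulOf ![n, 0, 0] ![l, 0, 0] ![g, 0, 0] ![k, h, 0] ![f, d, 0] ![c, b, a])
      fun _ _ => 0 := by
  obtain ⟨A, B, C, D, -, -⟩ := triangular_relations H
  clear H
  obtain rfl : k = (l ^ 2 - h * l) / n := by field_simp; linear_combination A
  obtain rfl : f = (l * g - d * l) / n := by field_simp; linear_combination B
  obtain rfl : c = (g ^ 2 - b * l - a * g) / n := by field_simp; linear_combination C
  refine .of_iso (isoPair_zero_of_frame ![1 / n, 0, 0] ![-l / n, 1, 0] ![-g / n, 0, 1]
    (by simp [det3, hn]) ?_) (classified_of_split D)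
  intro X Y; apply ext3 <;> simp [comb, mulOf] <;> field_simp <;> ring

lemma classified_triangular_of_ne' {l g k f c h d b a : ℂ} (hh : h ≠ 0) (H : TPA (mulOf ![0, 0, 0]
      ![l, 0, 0] ![g, 0, 0] ![k, h, 0] ![f, d, 0] ![c, b, a]) fun _ _ => 0) :
    Classified (mulOf ![0, 0, 0] ![l, 0, 0] ![g, 0, 0] ![k, h, 0] ![f, d, 0] ![c, b, a])
      fun _ _ => 0 := by
  obtain ⟨A, B, C, D, E, F⟩ := triangular_relations H
  clear H
  obtain rfl : b = (d ^ 2 - a * d) / h := by field_simp; linear_combination D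
  by_cases hl : l = 0
  · subst hl
    obtain rfl : f = (d * k - k * g) / h := by field_simp; linear_combination E
    refine .of_iso (m' := mulOf ![1, 0, 0] ![0, 0, 0] ![0, 0, 0] ![0, 0, 0] ![0, g, 0] ![0,
      c - (d ^ 2 - a * d) * k / h ^ 2, a])
      (isoPair_zero_of_frame ![k / h ^ 2, 1 / h, 0] ![1, 0, 0] ![- d * k / h ^ 2, -d / h, 1]
      (by simp [det3, hh]) ?_) (classified_of_split ?_)
    · intro X Y; apply ext3 <;> simp [comb, mulOf] <;> field_simp <;> ring
    · linear_combination C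
  · obtain rfl : l = h := by grind
    obtain rfl : g = d := by grind
    obtain rfl : c = (2 * f * g - (g ^ 2 - a * g) / l * k - a * f) / l := by
      field_simp at F ⊢; linear_combination -F
    by_cases ha : a = 0
    · subst ha
      refine ⟨.t25, trivial, isoPair_zero_of_frame ![-k / l ^ 2, 1 / l, 0] ![1, 0, 0]
        ![k * g / l ^ 2 - f / l, -g / l, 1] (by simp [det3, hl]) ?_⟩
      intro X Y; apply ext3 <;> simp [tMul, comb, mT25, mulOf] <;> field_simp <;> ring
    · refine ⟨.t21, trivial, isoPair_zero_of_frame ![-k / l ^ 2, 1 / l, 0]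
        ![(k * g / l ^ 2 - f / l) / a, -g / (l * a), 1 / a] ![1, 0, 0]
        (by simp [det3, hl, ha]) ?_⟩
      intro X Y; apply ext3 <;> simp [tMul, comb, mT21, mulOf] <;> field_simp <;> ring

lemma classified_triangular_of_idempotent {g k f c d b a : ℂ} (ha : a ≠ 0) (H : TPA (mulOf
      ![0, 0, 0] ![0, 0, 0] ![g, 0, 0] ![k, 0, 0] ![f, d, 0] ![c, b, a]) fun _ _ => 0) :
    Classified (mulOf ![0, 0, 0] ![0, 0, 0] ![g, 0, 0] ![k, 0, 0] ![f, d, 0] ![c, b, a])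
      fun _ _ => 0 := by
  obtain ⟨-, -, C, D, E, F⟩ := triangular_relations H
  clear H
  by_cases hd : d = 0
  · subst hd
    by_cases hg : g = 0
    · subst hg
      obtain rfl : f = -b * k / a := by field_simp; linear_combination -F
      by_cases hk : k = 0
      · subst hk
        refine ⟨.t27, trivial, isoPair_zero_of_frame ![c / a ^ 2, b / a ^ 2, 1 / a] ![0, 1, 0]
          ![1, 0, 0] (by simp [det3, ha]) ?_⟩
        intro X Y; apply ext3 <;> simp [tMul, comb, mT27, mulOf] <;> field_simp
      · refine ⟨.t26, trivial, isoPair_zero_of_frame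
          ![(c - b ^ 2 * k / a ^ 2) / a ^ 2, b / a ^ 2, 1 / a] ![0, 1, 0]
          ![k, 0, 0] (by simp [det3, ha, hk]) ?_⟩
        intro X Y; apply ext3 <;> simp [tMul, comb, mT26, mulOf] <;> field_simp <;> ring
    · obtain rfl : a = g := by grind
      obtain rfl : k = 0 := by grind
      refine ⟨.t25, trivial, isoPair_zero_of_frame
          ![-(c + b * f / a) / a ^ 2 - b * f / a ^ 3, b / a ^ 2, 1 / a] ![1, 0, 0]
          ![-f / a, 1, 0] (by simp [det3, ha]) ?_⟩
      intro X Y; apply ext3 <;> simp [tMul, comb, mT25, mulOf] <;> field_simp <;> ring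
  · obtain rfl : a = d := by grind
    by_cases hg : g = 0
    · subst hg
      obtain rfl : k = 0 := by grind
      refine ⟨.t25, trivial, isoPair_zero_of_frame
          ![(c - b * f / a) / a ^ 2 - b * f / a ^ 3, -b / a ^ 2, 1 / a] ![f / a, 1, 0]
          ![1, 0, 0] (by simp [det3, ha]) ?_⟩
      intro X Y; apply ext3 <;> simp [tMul, comb, mT25, mulOf] <;> field_simp <;> ring
    · obtain rfl : g = a := by grind
      obtain rfl : f = b * k / g := by field_simp; linear_combination F
      by_cases hk : k = 0
      · subst hk
        refine ⟨.t24, trivial, isoPair_zero_of_frame ![-c / g ^ 2, -b / g ^ 2, 1 / g] ![0, 1, 0]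
          ![1, 0, 0] (by simp [det3, ha]) ?_⟩
        intro X Y; apply ext3 <;> simp [tMul, comb, mT24, mulOf] <;> field_simp <;> ring
      · refine ⟨.t23, trivial, isoPair_zero_of_frame
          ![-(c - b ^ 2 * k / g ^ 2) / g ^ 2, -b / g ^ 2, 1 / g] ![0, 1, 0]
          ![k, 0, 0] (by simp [det3, ha, hk]) ?_⟩
        intro X Y; apply ext3 <;> simp [tMul, comb, mT23, mulOf] <;> field_simp <;> ring

lemma classified_of_symForm {k f c : ℂ} (h0 : ¬(k = 0 ∧ f = 0 ∧ c = 0)) :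
    Classified (mulOf ![0, 0, 0] ![0, 0, 0] ![0, 0, 0] ![k, 0, 0] ![f, 0, 0] ![c, 0, 0])
      fun _ _ => 0 := by
  by_cases hΔ : f ^ 2 = c * k
  · by_cases hc : c = 0
    · obtain rfl : f = 0 := by simpa [hc] using hΔ
      subst hc
      have hk : k ≠ 0 := by simpa using h0
      refine ⟨.t30, trivial, isoPair_zero_of_frame ![0, 1, 0] ![k, 0, 0] ![0, 0, 1]
        (by simp [det3, hk]) ?_⟩
      intro X Y; apply ext3 <;> simp [tMul, comb, mT30, mulOf]
    · obtain rfl : k = f ^ 2 / c := by field_simp; linear_combination -hΔ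
      refine ⟨.t30, trivial, isoPair_zero_of_frame ![0, 0, 1] ![c, 0, 0] ![0, c, -f]
        (by simp [det3, hc]) ?_⟩
      intro X Y; apply ext3 <;> simp [tMul, comb, mT30, mulOf] <;> field_simp <;> ring
  · by_cases hc : c = 0
    · subst hc
      have hf : f ≠ 0 := by rintro rfl; simp at hΔ
      refine ⟨.t29, trivial, isoPair_zero_of_frame ![0, 0, 1] ![0, 1, -k / (2 * f)] ![f, 0, 0]
        (by simp [det3, hf]) ?_⟩
      intro X Y; apply ext3 <;> simp [tMul, comb, mT29, mulOf] <;> field_simp <;> ring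
    · obtain ⟨δ, hδ⟩ := IsAlgClosed.exists_pow_nat_eq (f ^ 2 - c * k) (n := 2) (by norm_num)
      have hδ0 : δ ≠ 0 := by
        rintro rfl; apply hΔ; linear_combination -hδ
      obtain rfl : k = (f ^ 2 - δ ^ 2) / c := by field_simp; linear_combination hδ
      refine ⟨.t29, trivial, isoPair_zero_of_frame ![0, c, -f + δ] ![0, c, -f - δ]
        ![-2 * c * δ ^ 2, 0, 0] ?_ ?_⟩
      · have : det3 ![0, c, -f + δ] ![0, c, -f - δ] ![-2 * c * δ ^ 2, 0, 0] = 4 * c ^ 2 * δ ^ 3 := by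
          simp [det3]; ring
        rw [this]; simp [hc, hδ0]
      · intro X Y; apply ext3 <;> simp [tMul, comb, mT29, mulOf] <;> field_simp <;> ring

lemma classified_triangular {n l g k f c h d b a : ℂ} (H : TPA (mulOf ![n, 0, 0] ![l, 0, 0]
      ![g, 0, 0] ![k, h, 0] ![f, d, 0] ![c, b, a]) fun _ _ => 0)
    (h0 : mulOf ![n, 0, 0] ![l, 0, 0] ![g, 0, 0] ![k, h, 0] ![f, d, 0] ![c, b, a] ≠
      fun _ _ => 0) :
    Classified (mulOf ![n, 0, 0] ![l, 0, 0] ![g, 0, 0] ![k, h, 0] ![f, d, 0] ![c, b, a])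
      fun _ _ => 0 := by
  by_cases hn : n = 0
  swap; · exact classified_triangular_of_ne hn H
  subst hn
  by_cases hh : h = 0
  swap; · exact classified_triangular_of_ne' hh H
  subst hh
  obtain ⟨A, -, C, D, E, F⟩ := triangular_relations H
  obtain rfl : l = 0 := by simpa using A.symm
  by_cases ha : a = 0
  swap; · exact classified_triangular_of_idempotent ha H
  subst ha
  obtain rfl : g = 0 := by simpa using C.symm
  obtain rfl : d = 0 := by simpa using D.symm
  by_cases hb : b = 0
  · subst hb
    refine classified_of_symForm fun hz => h0 ?_
    obtain ⟨rfl, rfl, rfl⟩ := hz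
    funext X Y; apply ext3 <;> simp [mulOf]
  · obtain rfl : k = 0 := by simpa [hb] using F
    by_cases hf : f = 0
    · subst hf
      refine ⟨.t30, trivial, isoPair_zero_of_frame ![0, 0, 1] ![c, b, 0] ![1, 0, 0]
        (by simp [det3, hb]) ?_⟩
      intro X Y; apply ext3 <;> simp [tMul, comb, mT30, mulOf]
    · refine ⟨.t28, trivial, isoPair_zero_of_frame ![0, 0, 1] ![c, b, 0] ![b * f, 0, 0]
        (by simp [det3, hb, hf]) ?_⟩
      intro X Y; apply ext3 <;> simp [tMul, comb, mT28, mulOf] <;> ring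

lemma classified_zero {m : V3 → V3 → V3} (H : TPA m fun _ _ => 0) (h0 : m ≠ fun _ _ => 0) :
    Classified m fun _ _ => 0 := by
  obtain ⟨n, l, g, k, f, c, h, d, b, a, hi⟩ := H.exists_triangular
  refine .of_iso hi (classified_triangular (H.of_isoPair hi) fun hz => h0 ?_)
  rw [hz] at hi
  obtain ⟨φ, hφ, -⟩ := hi
  funext x y
  simpa using hφ x y

theorem TPA.classified {m b : V3 → V3 → V3} (h : TPA m b)
    (hnz : (∃ x y, m x y ≠ 0) ∨ (∃ x y, b x y ≠ 0)) : Classified m b := by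
  obtain ⟨b', hb', hi⟩ := (IsLie.mk h.br h.alt h.jac).hasStdForm
  obtain ⟨m', h', hi'⟩ := hi.exists_isoPair h
  refine .of_iso hi' ?_
  cases hb' with
  | zero =>
    refine classified_zero h' ?_
    rintro rfl
    obtain ⟨φ, h1, h2⟩ := hi'
    rcases hnz with ⟨x, y, hxy⟩ | ⟨x, y, hxy⟩
    · exact hxy (φ.map_eq_zero_iff.1 (h1 x y))
    · exact hxy (φ.map_eq_zero_iff.1 (h2 x y))
  | sl2 => exact classified_bsl2 h'
  | heis => exact classified_bh h'
  | g1 => exact classified_bg1 h'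
  | g2 α hα =>
    by_cases h0 : α = 0
    · subst h0; exact classified_bg2_zero h'
    · exact classified_bg2 h' h0 hα

lemma isoPair_of_tRel {i j : TIdx} (h : tRel i j) : IsoPair (tMul i) (tBr i) (tMul j) (tBr j) := by
  by_cases hij : i = j
  · subst hij; exact .refl _ _
  cases i <;> cases j <;> simp only [tRel, reduceCtorEq] at h <;> try contradiction
  · rename_i β β'
    have hβ : β = -β' := h.resolve_left fun h => hij (by rw [h])
    subst hβ
    refine isoPair_of_frame ![0, 1, 0] ![1, 0, 0] ![0, 0, -1] (by simp [det3]) ?_ ?_ <;>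
      intro X Y <;> apply ext3 <;> simp [tMul, tBr, mT03, bh, comb]
    rw [add_comm]; simp
  · rename_i α β α' β'
    obtain ⟨h0, rfl, rfl⟩ := h.resolve_left fun h => hij (by rw [h.1, h.2])
    refine isoPair_of_frame ![1, 0, 0] ![α⁻¹ - 1, α⁻¹, 0] ![0, 0, α⁻¹]
      (by simp [det3, h0]) ?_ ?_ <;>
      intro X Y <;> apply ext3 <;> simp [tMul, tBr, mT09, bg2, comb] <;> field_simp <;> ring
  · rename_i α α'
    obtain ⟨h0, rfl⟩ := h.resolve_left fun h => hij (by rw [h])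
    refine isoPair_of_frame ![α⁻¹ ^ 2, 0, 0] ![α⁻¹ ^ 3 - α⁻¹ ^ 2, α⁻¹ ^ 3, 0] ![0, 0, α⁻¹]
      (by simp [det3, h0]) ?_ ?_ <;>
      intro X Y <;> apply ext3 <;> simp [tMul, tBr, mT11, bg2, comb] <;> field_simp <;> ring

lemma IsoPair.exists_frame {m b m' b' : V3 → V3 → V3} (h : IsoPair m b m' b') :
    ∃ u v w, det3 u v w ≠ 0 ∧
      (∀ x y, comb u v w (m x y) = m' (comb u v w x) (comb u v w y)) ∧
      (∀ x y, comb u v w (b x y) = b' (comb u v w x) (comb u v w y)) := by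
  obtain ⟨φ, h1, h2⟩ := h
  have hφ : ∀ x, comb (φ (e 0)) (φ (e 1)) (φ (e 2)) x = φ x := by
    intro x
    conv_rhs => rw [eq_sum_e x]
    simp only [map_add, map_smul, map_zero]
    apply ext3 <;> simp [comb] <;> ring
  refine ⟨φ (e 0), φ (e 1), φ (e 2), fun hd => ?_, by simpa only [hφ] using h1,
    by simpa only [hφ] using h2⟩
  obtain ⟨x, hx, hx0⟩ := (Matrix.exists_vecMul_eq_zero_iff
    (M := Matrix.of ![φ (e 0), φ (e 1), φ (e 2)])).2 (by
      rw [← hd, Matrix.det_fin_three]; simp [det3]; ring)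
  refine hx (φ.map_eq_zero_iff.1 ?_)
  rw [← hφ, ← hx0]
  apply ext3 <;> simp [comb, Matrix.vecMul, dotProduct, Fin.sum_univ_three]

lemma frame_bh {u v w : V3} (hd : det3 u v w ≠ 0)
    (h : ∀ x y, comb u v w (bh x y) = bh (comb u v w x) (comb u v w y)) :
    w = ![0, 0, u 0 * v 1 - u 1 * v 0] ∧ u 0 * v 1 - u 1 * v 0 ≠ 0 := by
  have hw : w = ![0, 0, u 0 * v 1 - u 1 * v 0] := by
    have := h (e 0) (e 1)
    apply ext3
    · simpa [comb, bh, e] using congrFun this 0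
    · simpa [comb, bh, e] using congrFun this 1
    · simpa [comb, bh, e] using congrFun this 2
  refine ⟨hw, fun h0 => hd ?_⟩
  rw [hw, h0]; simp [det3]

lemma frame_bg1 {u v w : V3} (hd : det3 u v w ≠ 0)
    (h : ∀ x y, comb u v w (bg1 x y) = bg1 (comb u v w x) (comb u v w y)) :
    u 2 = 0 ∧ v 2 = 0 ∧ w 2 = 1 := by
  have H := fun c => And.intro (congrFun (h (e 0) (e 2)) c) (congrFun (h (e 1) (e 2)) c)
  simp [Fin.forall_fin_succ, comb, bg1, e] at H
  obtain ⟨⟨A, B⟩, ⟨C, D⟩, hu, hv⟩ := H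
  refine ⟨hu, hv, ?_⟩
  by_contra hw
  have hw' : w 2 - 1 ≠ 0 := sub_ne_zero.2 hw
  simp [hu, hv] at A B C D
  have hu0 : u 0 = 0 := by grind
  have hu1 : u 1 = 0 := by grind
  exact hd (by simp [det3, hu, hu0, hu1])

lemma frame_bg2 {α α' : ℂ} {u v w : V3} (hd : det3 u v w ≠ 0)
    (h : ∀ x y, comb u v w (bg2 α x y) = bg2 α' (comb u v w x) (comb u v w y)) :
    u 2 = 0 ∧ v 2 = 0 ∧
      ((α' = α ∧ v 0 = 0 ∧ w 2 = 1 ∧ u 0 ≠ 0 ∧ v 1 ≠ 0 ∧ v 1 = u 0 + u 1 * (α - 1)) ∨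
      (α * α' = 1 ∧ α ≠ 1 ∧ v 0 ≠ 0 ∧ v 0 = (1 - α') * v 1 ∧ u 0 = v 1 * α' ∧ w 2 = α)) := by
  have H := fun c => And.intro (congrFun (h (e 0) (e 1)) c)
    (And.intro (congrFun (h (e 0) (e 2)) c) (congrFun (h (e 1) (e 2)) c))
  simp [Fin.forall_fin_succ, comb, bg2, e] at H
  obtain ⟨⟨A0, B0, C0⟩, ⟨A1, B1, C1⟩, hu, hv⟩ := H
  have huv : u 2 = 0 ∧ v 2 = 0 := by
    by_contra hne
    have hv2 : v 2 = - u 2 := by linear_combination hu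
    have hu2 : u 2 ≠ 0 := by
      intro h0; apply hne; simp [h0, hv2]
    obtain rfl : α = 0 := by rcases hv with h | h; exacts [h, by grind]
    have h0 : u 0 + v 0 = 0 := by grind
    have h1 : u 1 + v 1 = 0 := by grind
    apply hd
    rw [det3, hv2, eq_neg_of_add_eq_zero_right h0, eq_neg_of_add_eq_zero_right h1]
    ring
  obtain ⟨hu2, hv2⟩ := huv
  simp [hu2, hv2] at A0 B0 C0 A1 B1 C1
  have hd' : (u 0 * v 1 - u 1 * v 0) ≠ 0 := by
    intro h0; apply hd; simp [det3, hu2, hv2]; grind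
  have hw2 : w 2 ≠ 0 := by
    intro h0; apply hd; simp [det3, hu2, hv2, h0]
  refine ⟨hu2, hv2, ?_⟩
  by_cases hv0 : v 0 = 0
  · left
    have hu0 : u 0 ≠ 0 := by rintro h0; simp [h0, hv0] at hd'
    have hv1 : v 1 ≠ 0 := by rintro h0; simp [h0, hv0] at hd'
    have hw : w 2 = 1 := by grind
    have hα : α' = α := by grind
    exact ⟨hα, hv0, hw, hu0, hv1, by grind⟩
  · right
    have hw : w 2 = α := by grind
    have hα : α ≠ 0 := hw ▸ hw2
    have h1 : v 0 = (1 - α') * v 1 := by grind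
    have h2 : α' ≠ 1 := by grind
    have h3 : v 1 ≠ 0 := by grind
    have h4 : α * α' = 1 := by
      have hk : (α * α' - 1) * (u 0 * v 1 - u 1 * v 0) = 0 := by
        rw [hw] at B0 B1
        have hA : v 0 = u 0 * (α - 1) := by linear_combination B0
        have hB : v 1 = u 0 * α + (α * α' - 1) * u 1 := by linear_combination B1
        linear_combination -((α * α' - 1) * u 1) * hA + u 0 * (α - 1) * hB - u 0 * α * hA +
          u 0 * α * h1
      exact sub_eq_zero.1 ((mul_eq_zero.1 hk).resolve_right hd')
    refine ⟨h4, by grind, hv0, h1, by grind, hw⟩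

/-- Common form of the products on `bg2 α` in the list. -/
def planarMul (p q s r t β a c : ℂ) : V3 → V3 → V3 :=
  mulOf ![0, p, 0] ![0, q, 0] ![β, r, 0] ![0, s, 0] ![0, t, 0] ![a, c, β]

lemma isoPair_planar {α p q s r t β a c α' p' q' s' r' t' β' a' c' : ℂ}
    (h : IsoPair (planarMul p q s r t β a c) (bg2 α) (planarMul p' q' s' r' t' β' a' c') (bg2 α')) :
    (α' = α ∧ β' = β ∧ ∃ S T Q x y : ℂ, S ≠ 0 ∧ Q ≠ 0 ∧ Q = S + T * (α - 1) ∧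
      p * Q = S ^ 2 * p' + 2 * S * T * q' + T ^ 2 * s' ∧
      q = S * q' + T * s' ∧ s = Q * s' ∧ t = x * q' + y * s' + t' ∧
      β * T + r * Q = S * (x * p' + y * q' + r') + T * (x * q' + y * s' + t') ∧
      a * S = β * x + a' ∧
      a * T + c * Q + β * y = x ^ 2 * p' + 2 * x * y * q' + y ^ 2 * s' + 2 * x * r' + 2 * y * t' + c') ∨
    (α * α' = 1 ∧ α ≠ 1 ∧ (q = 0 → s = 0 → t = β → q' = 0 → s' = 0 → t' = β' →
      β = α * β' ∧ p = 0 ∧ p' = 0 ∧ r = 0 ∧ r' = 0 ∧ (β = 0 → ∃ S T Q : ℂ, S ≠ 0 ∧ Q ≠ 0 ∧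
        a * S + c * ((1 - α') * Q) = α ^ 2 * a' ∧ a * T + c * Q = α ^ 2 * c'))) := by
  obtain ⟨u, v, w, hd, h1, h2⟩ := h.exists_frame
  obtain ⟨hu2, hv2, ⟨hα, hv0, hw2, hu0, hv1, hq⟩ | ⟨hα, hα1, hv0, hv, hu, hw2⟩⟩ := frame_bg2 hd h2
  all_goals
    have A := h1 (e 0) (e 0)
    have B := h1 (e 0) (e 1)
    have C := h1 (e 0) (e 2)
    have D := h1 (e 1) (e 1)
    have E := h1 (e 1) (e 2)
    have F := h1 (e 2) (e 2)
    have A1 := congrFun A 1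
    have B1 := congrFun B 1
    have C0 := congrFun C 0
    have C1 := congrFun C 1
    have D1 := congrFun D 1
    have E1 := congrFun E 1
    have F0 := congrFun F 0
    have F1 := congrFun F 1
    have F2 := congrFun F 2
    clear A B C D E F h h1 h2 hd
    simp [planarMul, mulOf, comb, e, hu2, hv2, hw2] at A1 B1 C0 C1 D1 E1 F0 F1 F2
  · left
    simp [hv0] at A1 B1 C1 D1 E1 F0 F1 F2
    subst F2
    refine ⟨hα, rfl, u 0, u 1, v 1, w 0, w 1, hu0, hv1, hq, by linear_combination A1,
      mul_right_cancel₀ hv1 (by linear_combination B1),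
      mul_right_cancel₀ hv1 (by linear_combination D1),
      mul_right_cancel₀ hv1 (by linear_combination E1), by linear_combination C1,
      by linear_combination F0, by linear_combination F1⟩
  · right
    refine ⟨hα, hα1, ?_⟩
    intros
    subst_vars
    have hv1 : v 1 ≠ 0 := by rintro h; simp [h] at hv; exact hv0 hv
    have hw0 : w 2 ≠ 0 := left_ne_zero_of_mul_eq_one hα
    simp [hv0] at A1 C0 D1 E1 F0 F1 F2
    subst D1
    have hβ : β = w 2 * β' := mul_right_cancel₀ hw0 (by linear_combination F2)
    have hp : p = 0 := by simpa [hv1] using A1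
    have hr : r = 0 := by
      have : r * v 0 = 0 := by linear_combination C0 - u 0 * hβ
      exact (mul_eq_zero.1 this).resolve_right hv0
    have hr' : r' = 0 := by
      have : (v 0 * w 2) * r' = 0 := by linear_combination v 1 * hβ - E1
      exact (mul_eq_zero.1 this).resolve_left (mul_ne_zero hv0 hw0)
    refine ⟨hβ, hp, rfl, hr, hr', fun hβ0 => ⟨u 0, u 1, v 1, ?_, hv1, ?_, ?_⟩⟩
    · rw [hu]; exact mul_ne_zero hv1 (right_ne_zero_of_mul_eq_one hα)
    · linear_combination F0 - c * hv - w 0 * hβ0 + 2 * w 0 * (hβ0 - hβ)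
    · linear_combination F1 - w 1 * hβ0 + 2 * w 1 * (hβ0 - hβ) + 2 * w 0 * w 2 * hr'

/-- The indices with bracket `bg2 α`, with the coefficients of their products. -/
inductive PlanarIdx : TIdx → ℂ → ℂ → ℂ → ℂ → ℂ → ℂ → ℂ → ℂ → ℂ → Prop
  | t09 (α β : ℂ) : PlanarIdx (.t09 α β) α 0 0 0 0 β β 0 0
  | t10 (α : ℂ) : PlanarIdx (.t10 α) α 0 0 0 0 0 0 0 1
  | t11 (α : ℂ) : PlanarIdx (.t11 α) α 0 0 0 0 0 0 1 0
  | t12 (β : ℂ) : PlanarIdx (.t12 β) 2 1 0 0 0 β β 0 0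
  | t13 : PlanarIdx .t13 2 1 0 0 0 0 0 0 1
  | t14 : PlanarIdx .t14 2 0 0 0 1 0 0 1 0
  | t15 : PlanarIdx .t15 2 0 0 0 1 0 0 0 0
  | t16 : PlanarIdx .t16 0 0 0 0 0 0 0 1 1
  | t17 (β : ℂ) : PlanarIdx (.t17 β) 0 1 (-1) 1 0 β β 0 0
  | t18 : PlanarIdx .t18 0 1 (-1) 1 0 0 0 1 1
  | t19 (γ : ℂ) : γ ≠ 0 → PlanarIdx (.t19 γ) 0 0 0 0 γ 0 γ 0 0

lemma PlanarIdx.eq {i : TIdx} {α p q s r t β a c : ℂ} (h : PlanarIdx i α p q s r t β a c) :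
    tMul i = planarMul p q s r t β a c ∧ tBr i = bg2 α := by
  cases h <;> refine ⟨?_, rfl⟩ <;> funext x y <;> apply ext3 <;>
    simp [tMul, planarMul, mulOf, mT09, mT10, mT11, mT12, mT13, mT14, mT15, mT16, mT17, mT18,
      mT19] <;> ring

lemma PlanarIdx.tRel_of_isoPair {i j : TIdx} {α p q s r t β a c α' p' q' s' r' t' β' a' c' : ℂ}
    (hi : PlanarIdx i α p q s r t β a c) (hj : PlanarIdx j α' p' q' s' r' t' β' a' c')
    (h : IsoPair (tMul i) (tBr i) (tMul j) (tBr j)) : tRel i j := by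
  rw [hi.eq.1, hi.eq.2, hj.eq.1, hj.eq.2] at h
  obtain ⟨h1, h2, S, T, Q, x, y, hS, hQ, hSQ, H⟩ | ⟨h1, h2, H⟩ := isoPair_planar h
  · clear h
    cases hi <;> cases hj <;> simp [tRel] at * <;> grind
  · clear h
    cases hi <;> cases hj <;> simp [tRel] at * <;> grind

/-- Common form of the products on `bh` in the list. -/
def heisMul (p c β f g : ℂ) : V3 → V3 → V3 :=
  mulOf ![0, 0, p] ![c, 0, β] 0 ![f, c, g] ![0, 0, c] 0

/-- The indices with bracket `bh`, with the coefficients of their products. -/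
inductive HeisIdx : TIdx → ℂ → ℂ → ℂ → ℂ → ℂ → Prop
  | t02 : HeisIdx .t02 0 0 0 0 1
  | t03 (β : ℂ) : HeisIdx (.t03 β) 0 0 β 0 0
  | t04 (β : ℂ) : HeisIdx (.t04 β) 0 0 β 1 0
  | t05 : HeisIdx .t05 1 1 0 0 0
  | t06 : HeisIdx .t06 0 1 0 0 0

lemma HeisIdx.eq {i : TIdx} {p c β f g : ℂ} (h : HeisIdx i p c β f g) :
    tMul i = heisMul p c β f g ∧ tBr i = bh := by
  cases h <;> refine ⟨?_, rfl⟩ <;> funext x y <;> apply ext3 <;>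
    simp [tMul, heisMul, mulOf, mT02, mT03, mT04, mT05, mT06] <;> ring

lemma HeisIdx.tRel_of_isoPair {i j : TIdx} {p c β f g p' c' β' f' g' : ℂ}
    (hi : HeisIdx i p c β f g) (hj : HeisIdx j p' c' β' f' g')
    (h : IsoPair (tMul i) (tBr i) (tMul j) (tBr j)) : tRel i j := by
  rw [hi.eq.1, hi.eq.2, hj.eq.1, hj.eq.2] at h
  obtain ⟨u, v, w, hd, h1, h2⟩ := h.exists_frame
  obtain ⟨rfl, hD⟩ := frame_bh hd h2
  have H := fun k => And.intro (congrFun (h1 (e 0) (e 0)) k)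
    (And.intro (congrFun (h1 (e 0) (e 1)) k) (congrFun (h1 (e 1) (e 1)) k))
  simp [Fin.forall_fin_succ, heisMul, mulOf, comb, e] at H
  clear h h1 h2 hd
  cases hi <;> cases hj <;> simp [tRel] at * <;> grind

/-- The indices with bracket `bg1`. -/
inductive AffIdx : TIdx → Prop
  | t07 (β : ℂ) : AffIdx (.t07 β)
  | t08 : AffIdx .t08

lemma AffIdx.tBr_eq {i : TIdx} (h : AffIdx i) : tBr i = bg1 := by
  cases h <;> rfl

lemma AffIdx.tRel_of_isoPair {i j : TIdx} (hi : AffIdx i) (hj : AffIdx j)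
    (h : IsoPair (tMul i) (tBr i) (tMul j) (tBr j)) : tRel i j := by
  rw [hi.tBr_eq, hj.tBr_eq] at h
  obtain ⟨u, v, w, hd, h1, h2⟩ := h.exists_frame
  obtain ⟨hu, hv, hw⟩ := frame_bg1 hd h2
  have A := h1 (e 2) (e 2)
  have A0 := congrFun A 0
  have A1 := congrFun A 1
  have A2 := congrFun A 2
  clear A h h1 h2
  cases hi <;> cases hj <;>
    simp [tRel, tMul, mT07, mT08, comb, e, hu, hv, hw, det3] at A0 A1 A2 hd ⊢
  all_goals grind

def IsUnital (m : V3 → V3 → V3) : Prop := ∃ x, ∀ y, m x y = y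

def IsSquareReduced (m : V3 → V3 → V3) : Prop := ∀ x, m x x = 0 → x = 0

def CubeZeroImpSquareZero (m : V3 → V3 → V3) : Prop := ∀ x, m (m x x) x = 0 → m x x = 0

def HasIdempotent (m : V3 → V3 → V3) : Prop := ∃ x, x ≠ 0 ∧ m x x = x

def HasOrthogonalIdempotents (m : V3 → V3 → V3) : Prop :=
  ∃ x y, x ≠ 0 ∧ y ≠ 0 ∧ m x x = x ∧ m y y = y ∧ m x y = 0

def HasFixedSquareZero (m : V3 → V3 → V3) : Prop := ∃ x y, x ≠ 0 ∧ m x x = 0 ∧ m x y = x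

def HasCube (m : V3 → V3 → V3) : Prop := ∃ x, m (m x x) x ≠ 0

def SquareZeroImpMulZero (m : V3 → V3 → V3) : Prop :=
  ∀ x y, m x x = 0 → m y y = 0 → m x y = 0

section Invariance

variable {m b m' b' : V3 → V3 → V3}

lemma IsoPair.exists_mul (h : IsoPair m b m' b') :
    ∃ φ : V3 ≃ₗ[ℂ] V3, ∀ x y, m' (φ x) (φ y) = φ (m x y) := by
  obtain ⟨φ, h1, -⟩ := h
  exact ⟨φ, fun x y => (h1 x y).symm⟩

lemma IsoPair.exists_br (h : IsoPair m b m' b') :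
    ∃ φ : V3 ≃ₗ[ℂ] V3, ∀ x y, b' (φ x) (φ y) = φ (b x y) := by
  obtain ⟨φ, -, h1⟩ := h
  exact ⟨φ, fun x y => (h1 x y).symm⟩

lemma IsoPair.iff_of_imp {P : (V3 → V3 → V3) → (V3 → V3 → V3) → Prop}
    (hP : ∀ m b m' b', IsoPair m b m' b' → P m b → P m' b') (h : IsoPair m b m' b') :
    P m b ↔ P m' b' :=
  ⟨hP _ _ _ _ h, hP _ _ _ _ h.symm⟩

lemma IsoPair.isUnital_iff (h : IsoPair m b m' b') : IsUnital m ↔ IsUnital m' := by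
  refine h.iff_of_imp (P := fun m _ => IsUnital m) fun m b m' b' h => ?_
  obtain ⟨φ, hφ⟩ := h.exists_mul
  rintro ⟨x, hx⟩
  exact ⟨φ x, φ.surjective.forall.2 fun y => by rw [hφ, hx]⟩

lemma IsoPair.isSquareReduced_iff (h : IsoPair m b m' b') :
    IsSquareReduced m ↔ IsSquareReduced m' := by
  refine h.iff_of_imp (P := fun m _ => IsSquareReduced m) fun m b m' b' h => ?_
  obtain ⟨φ, hφ⟩ := h.exists_mul
  exact fun H => φ.surjective.forall.2 fun x => by simpa [hφ] using H x

lemma IsoPair.cubeZeroImpSquareZero_iff (h : IsoPair m b m' b') :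
    CubeZeroImpSquareZero m ↔ CubeZeroImpSquareZero m' := by
  refine h.iff_of_imp (P := fun m _ => CubeZeroImpSquareZero m) fun m b m' b' h => ?_
  obtain ⟨φ, hφ⟩ := h.exists_mul
  exact fun H => φ.surjective.forall.2 fun x => by simpa [hφ] using H x

lemma IsoPair.hasIdempotent_iff (h : IsoPair m b m' b') :
    HasIdempotent m ↔ HasIdempotent m' := by
  refine h.iff_of_imp (P := fun m _ => HasIdempotent m) fun m b m' b' h => ?_
  obtain ⟨φ, hφ⟩ := h.exists_mul
  exact fun ⟨x, hx⟩ => ⟨φ x, by simpa [hφ] using hx⟩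

lemma IsoPair.hasOrthogonalIdempotents_iff (h : IsoPair m b m' b') :
    HasOrthogonalIdempotents m ↔ HasOrthogonalIdempotents m' := by
  refine h.iff_of_imp (P := fun m _ => HasOrthogonalIdempotents m) fun m b m' b' h => ?_
  obtain ⟨φ, hφ⟩ := h.exists_mul
  exact fun ⟨x, y, hx⟩ => ⟨φ x, φ y, by simpa [hφ] using hx⟩

lemma IsoPair.hasFixedSquareZero_iff (h : IsoPair m b m' b') :
    HasFixedSquareZero m ↔ HasFixedSquareZero m' := by
  refine h.iff_of_imp (P := fun m _ => HasFixedSquareZero m) fun m b m' b' h => ?_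
  obtain ⟨φ, hφ⟩ := h.exists_mul
  exact fun ⟨x, y, hx⟩ => ⟨φ x, φ y, by simpa [hφ] using hx⟩

lemma IsoPair.hasCube_iff (h : IsoPair m b m' b') : HasCube m ↔ HasCube m' := by
  refine h.iff_of_imp (P := fun m _ => HasCube m) fun m b m' b' h => ?_
  obtain ⟨φ, hφ⟩ := h.exists_mul
  exact fun ⟨x, hx⟩ => ⟨φ x, by simpa [hφ] using hx⟩

lemma IsoPair.squareZeroImpMulZero_iff (h : IsoPair m b m' b') :
    SquareZeroImpMulZero m ↔ SquareZeroImpMulZero m' := by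
  refine h.iff_of_imp (P := fun m _ => SquareZeroImpMulZero m) fun m b m' b' h => ?_
  obtain ⟨φ, hφ⟩ := h.exists_mul
  exact fun H => φ.surjective.forall.2 fun x => φ.surjective.forall.2 fun y => by
    simpa [hφ] using H x y

end Invariance

lemma eq_iff_coords {x y : V3} : x = y ↔ x 0 = y 0 ∧ x 1 = y 1 ∧ x 2 = y 2 :=
  ⟨fun h => by simp [h], fun h => ext3 h.1 h.2.1 h.2.2⟩

lemma isUnital_values :
    IsUnital mT20 ∧ IsUnital mT21 ∧ ¬ IsUnital mT22 ∧ IsUnital mT23 ∧ IsUnital mT24 ∧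
      ¬ IsUnital mT25 ∧ ¬ IsUnital mT26 ∧ ¬ IsUnital mT27 := by
  refine ⟨⟨![1, 1, 1], ?_⟩, ⟨![1, 1, 0], ?_⟩, ?_, ⟨![1, 0, 0], ?_⟩, ⟨![1, 0, 0], ?_⟩, ?_, ?_, ?_⟩
  any_goals
    intro y
    apply ext3 <;> simp [mT20, mT21, mT23, mT24]
  · rintro ⟨x, hx⟩; simpa [mT22, e] using congrFun (hx (e 2)) 2
  · rintro ⟨x, hx⟩; simpa [mT25, e] using congrFun (hx (e 2)) 2
  · rintro ⟨x, hx⟩; simpa [mT26, e] using congrFun (hx (e 2)) 2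
  · rintro ⟨x, hx⟩; simpa [mT27, e] using congrFun (hx (e 2)) 2

lemma isSquareReduced_values : IsSquareReduced mT20 ∧ ¬ IsSquareReduced mT21 := by
  constructor
  · intro x hx; simpa [mT20, eq_iff_coords] using hx
  · intro h; simpa [e] using congrFun (h (e 2) (by simp [mT21, e])) 2

lemma cubeZeroImpSquareZero_values :
    ¬ CubeZeroImpSquareZero mT23 ∧ CubeZeroImpSquareZero mT24 ∧ CubeZeroImpSquareZero mT25 ∧
      ¬ CubeZeroImpSquareZero mT26 ∧ CubeZeroImpSquareZero mT27 := by
  refine ⟨fun h => ?_, fun x => ?_, fun x => ?_, fun h => ?_, fun x => ?_⟩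
  · simpa [mT23, e] using congrFun (h (e 1) (by simp [mT23, e])) 2
  · simp +contextual [mT24]
  · simp +contextual [mT25]
  · simpa [mT26, e] using congrFun (h (e 1) (by simp [mT26, e])) 2
  · simp [mT27]

lemma hasIdempotent_values :
    HasIdempotent mT20 ∧ HasIdempotent mT21 ∧ HasIdempotent mT22 ∧ HasIdempotent mT23 ∧
      HasIdempotent mT24 ∧ HasIdempotent mT25 ∧ HasIdempotent mT26 ∧ HasIdempotent mT27 ∧
      ¬ HasIdempotent mT28 ∧ ¬ HasIdempotent mT29 ∧ ¬ HasIdempotent mT30 := by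
  refine ⟨⟨e 0, ?_⟩, ⟨e 0, ?_⟩, ⟨e 0, ?_⟩, ⟨e 0, ?_⟩, ⟨e 0, ?_⟩, ⟨e 0, ?_⟩, ⟨e 0, ?_⟩, ⟨e 0, ?_⟩,
    ?_, ?_, ?_⟩
  any_goals simp [eq_iff_coords, mT20, mT21, mT22, mT23, mT24, mT25, mT26, mT27, e]
  all_goals
    rintro ⟨x, h0, h⟩
    simp [eq_iff_coords, mT28, mT29, mT30] at h h0
    grind

lemma hasOrthogonalIdempotents_values :
    HasOrthogonalIdempotents mT20 ∧ HasOrthogonalIdempotents mT21 ∧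
      HasOrthogonalIdempotents mT22 ∧ ¬ HasOrthogonalIdempotents mT23 ∧
      ¬ HasOrthogonalIdempotents mT24 ∧ ¬ HasOrthogonalIdempotents mT25 ∧
      ¬ HasOrthogonalIdempotents mT26 ∧ ¬ HasOrthogonalIdempotents mT27 := by
  refine ⟨⟨e 0, e 1, ?_⟩, ⟨e 0, e 1, ?_⟩, ⟨e 0, e 1, ?_⟩, ?_, ?_, ?_, ?_, ?_⟩
  any_goals simp [eq_iff_coords, mT20, mT21, mT22, e]
  all_goals
    rintro ⟨x, y, hx, hy, h1, h2, h3⟩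
    simp [eq_iff_coords, mT23, mT24, mT25, mT26, mT27] at hx hy h1 h2 h3
    grind

lemma hasFixedSquareZero_values : HasFixedSquareZero mT25 ∧ ¬ HasFixedSquareZero mT27 := by
  refine ⟨⟨e 1, e 0, ?_⟩, ?_⟩
  · simp [eq_iff_coords, mT25, e]
  · rintro ⟨x, y, hx, h1, h2⟩
    simp [eq_iff_coords, mT27] at hx h1 h2
    grind

lemma hasCube_values : HasCube mT28 ∧ ¬ HasCube mT29 ∧ ¬ HasCube mT30 := by
  refine ⟨⟨e 0, ?_⟩, ?_, ?_⟩
  · simp [mT28, e]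
  · rintro ⟨x, hx⟩; simp [mT29] at hx
  · rintro ⟨x, hx⟩; simp [mT30] at hx

lemma squareZeroImpMulZero_values : ¬ SquareZeroImpMulZero mT29 ∧ SquareZeroImpMulZero mT30 := by
  refine ⟨fun h => ?_, fun x y => ?_⟩
  · simpa [mT29, e] using congrFun (h (e 0) (e 1) (by simp [mT29, e])
      (by simp [mT29, e])) 2
  · simp +contextual [mT30]

/-- The indices with zero bracket. -/
inductive ZeroIdx : TIdx → Prop
  | t20 : ZeroIdx .t20 | t21 : ZeroIdx .t21 | t22 : ZeroIdx .t22 | t23 : ZeroIdx .t23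
  | t24 : ZeroIdx .t24 | t25 : ZeroIdx .t25 | t26 : ZeroIdx .t26 | t27 : ZeroIdx .t27
  | t28 : ZeroIdx .t28 | t29 : ZeroIdx .t29 | t30 : ZeroIdx .t30

lemma ZeroIdx.tRel_of_isoPair {i j : TIdx} (hi : ZeroIdx i) (hj : ZeroIdx j)
    (h : IsoPair (tMul i) (tBr i) (tMul j) (tBr j)) : tRel i j := by
  have h1 := h.isUnital_iff
  have h2 := h.isSquareReduced_iff
  have h3 := h.cubeZeroImpSquareZero_iff
  have h4 := h.hasIdempotent_iff
  have h5 := h.hasOrthogonalIdempotents_iff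
  have h6 := h.hasFixedSquareZero_iff
  have h7 := h.hasCube_iff
  have h8 := h.squareZeroImpMulZero_iff
  clear h
  cases hi <;> cases hj <;>
    simp [tMul, tRel, isUnital_values, isSquareReduced_values, cubeZeroImpSquareZero_values,
      hasIdempotent_values, hasOrthogonalIdempotents_values, hasFixedSquareZero_values,
      hasCube_values, squareZeroImpMulZero_values] at h1 h2 h3 h4 h5 h6 h7 h8 ⊢

def IsTrivial (b : V3 → V3 → V3) : Prop := ∀ x y, b x y = 0

def IsTwoStepNilpotent (b : V3 → V3 → V3) : Prop := ∀ x y z, b (b x y) z = 0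

def IsMetabelian (b : V3 → V3 → V3) : Prop := ∀ x y z w, b (b x y) (b z w) = 0

def IsSpanClosed (b : V3 → V3 → V3) : Prop := ∀ x y, ∃ c d : ℂ, b x y = c • x + d • y

section Invariance

variable {m b m' b' : V3 → V3 → V3}

lemma IsoPair.isTrivial_iff (h : IsoPair m b m' b') : IsTrivial b ↔ IsTrivial b' := by
  refine h.iff_of_imp (P := fun _ b => IsTrivial b) fun m b m' b' h => ?_
  obtain ⟨φ, hφ⟩ := h.exists_br
  exact fun H => φ.surjective.forall.2 fun x => φ.surjective.forall.2 fun y => by simp [hφ, H x y]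

lemma IsoPair.isTwoStepNilpotent_iff (h : IsoPair m b m' b') :
    IsTwoStepNilpotent b ↔ IsTwoStepNilpotent b' := by
  refine h.iff_of_imp (P := fun _ b => IsTwoStepNilpotent b) fun m b m' b' h => ?_
  obtain ⟨φ, hφ⟩ := h.exists_br
  exact fun H => φ.surjective.forall.2 fun x => φ.surjective.forall.2 fun y =>
    φ.surjective.forall.2 fun z => by simp [hφ, H x y z]

lemma IsoPair.isMetabelian_iff (h : IsoPair m b m' b') : IsMetabelian b ↔ IsMetabelian b' := by
  refine h.iff_of_imp (P := fun _ b => IsMetabelian b) fun m b m' b' h => ?_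
  obtain ⟨φ, hφ⟩ := h.exists_br
  exact fun H => φ.surjective.forall.2 fun x => φ.surjective.forall.2 fun y =>
    φ.surjective.forall.2 fun z => φ.surjective.forall.2 fun w => by simp [hφ, H x y z w]

lemma IsoPair.isSpanClosed_iff (h : IsoPair m b m' b') : IsSpanClosed b ↔ IsSpanClosed b' := by
  refine h.iff_of_imp (P := fun _ b => IsSpanClosed b) fun m b m' b' h => ?_
  obtain ⟨φ, hφ⟩ := h.exists_br
  refine fun H => φ.surjective.forall.2 fun x => φ.surjective.forall.2 fun y => ?_
  obtain ⟨c, d, hcd⟩ := H x y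
  exact ⟨c, d, by simp [hφ, hcd]⟩

end Invariance

lemma isTrivial_values :
    IsTrivial (fun _ _ => 0) ∧ ¬ IsTrivial bsl2 ∧ ¬ IsTrivial bh ∧ ¬ IsTrivial bg1 ∧
      ∀ α, ¬ IsTrivial (bg2 α) := by
  refine ⟨fun _ _ => rfl, fun h => ?_, fun h => ?_, fun h => ?_, fun α h => ?_⟩
  · simpa [bsl2, e] using congrFun (h (e 0) (e 1)) 2
  · simpa [bh, e] using congrFun (h (e 0) (e 1)) 2
  · simpa [bg1, e] using congrFun (h (e 0) (e 2)) 0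
  · simpa [bg2, e] using congrFun (h (e 0) (e 2)) 0

lemma isTwoStepNilpotent_values :
    IsTwoStepNilpotent bh ∧ ¬ IsTwoStepNilpotent bg1 ∧ ∀ α, ¬ IsTwoStepNilpotent (bg2 α) := by
  refine ⟨fun x y z => by simp [bh], fun h => ?_, fun α h => ?_⟩
  · simpa [bg1, e] using congrFun (h (e 0) (e 2) (e 2)) 0
  · simpa [bg2, e] using congrFun (h (e 0) (e 2) (e 2)) 0

lemma isMetabelian_values :
    ¬ IsMetabelian bsl2 ∧ IsMetabelian bh ∧ IsMetabelian bg1 ∧ ∀ α, IsMetabelian (bg2 α) := by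
  refine ⟨fun h => ?_, fun x y z w => by simp [bh], fun x y z w => by simp [bg1],
    fun α x y z w => by simp [bg2]⟩
  simpa [bsl2, e] using congrFun (h (e 0) (e 1) (e 0) (e 2)) 0

lemma isSpanClosed_values : IsSpanClosed bg1 ∧ ∀ α, ¬ IsSpanClosed (bg2 α) := by
  refine ⟨fun x y => ⟨y 2, -x 2, ?_⟩, fun α h => ?_⟩
  · apply ext3 <;> simp [bg1] <;> ring
  · obtain ⟨c, d, h⟩ := h (e 0) (e 2)
    simpa [bg2, e] using congrFun h 1

lemma tIdx_cases {i : TIdx} (hi : tValid i) :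
    (i = .t01 ∧ tBr i = bsl2) ∨ (tBr i = bh ∧ ∃ p c β f g, HeisIdx i p c β f g) ∨
      (tBr i = bg1 ∧ AffIdx i) ∨
      (∃ α, tBr i = bg2 α ∧ ∃ p q s r t β a c, PlanarIdx i α p q s r t β a c) ∨
      (tBr i = (fun _ _ => 0) ∧ ZeroIdx i) := by
  cases i
  case t01 => exact .inl ⟨rfl, rfl⟩
  case t19 => exact .inr (.inr (.inr (.inl ⟨_, rfl, _, _, _, _, _, _, _, _, .t19 _ hi⟩)))
  case t07 | t08 => exact .inr (.inr (.inl ⟨rfl, by constructor⟩))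
  case t02 | t03 | t04 | t05 | t06 =>
    refine .inr (.inl ⟨rfl, ?_⟩)
    iterate 5 apply Exists.intro
    constructor
  case t09 | t10 | t11 | t12 | t13 | t14 | t15 | t16 | t17 | t18 =>
    refine .inr (.inr (.inr (.inl ⟨_, rfl, ?_⟩)))
    iterate 8 apply Exists.intro
    constructor
  all_goals exact .inr (.inr (.inr (.inr ⟨rfl, by constructor⟩)))

lemma tRel_of_isoPair {i j : TIdx} (hi : tValid i) (hj : tValid j)
    (h : IsoPair (tMul i) (tBr i) (tMul j) (tBr j)) : tRel i j := by
  have h1 := h.isTrivial_iff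
  have h2 := h.isTwoStepNilpotent_iff
  have h3 := h.isMetabelian_iff
  have h4 := h.isSpanClosed_iff
  rcases tIdx_cases hi with ⟨rfl, ei⟩ | ⟨ei, _, _, _, _, _, hi'⟩ | ⟨ei, hi'⟩ |
    ⟨_, ei, _, _, _, _, _, _, _, _, hi'⟩ | ⟨ei, hi'⟩ <;>
  rcases tIdx_cases hj with ⟨rfl, ej⟩ | ⟨ej, _, _, _, _, _, hj'⟩ | ⟨ej, hj'⟩ |
    ⟨_, ej, _, _, _, _, _, _, _, _, hj'⟩ | ⟨ej, hj'⟩ <;>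
  first
  | exact hi'.tRel_of_isoPair hj' h
  | rfl
  | simp [ei, ej, isTrivial_values, isTwoStepNilpotent_values, isMetabelian_values,
      isSpanClosed_values] at h1 h2 h3 h4

theorem statement14 (m b : V3 → V3 → V3)
    (hm : Bilinear m) (hb : Bilinear b)
    (hcomm : ∀ x y, m x y = m y x)
    (hassoc : ∀ x y z, m (m x y) z = m x (m y z))
    (halt : ∀ x, b x x = 0)
    (hjac : ∀ x y z, b (b x y) z + b (b y z) x + b (b z x) y = 0)
    (hcompat : ∀ x y z, (2 : ℂ) • m z (b x y) = b (m z x) y + b x (m z y))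
    (hnz : (∃ x y, m x y ≠ 0) ∨ (∃ x y, b x y ≠ 0)) :
    (∃ i : TIdx, tValid i ∧ IsoPair m b (tMul i) (tBr i)) ∧
    (∀ i j : TIdx, tValid i → tValid j →
      (IsoPair (tMul i) (tBr i) (tMul j) (tBr j) ↔ tRel i j)) := by 
  have h : TPA m b := ⟨hm, hb, hcomm, hassoc, halt, hjac, hcompat⟩
  exact ⟨h.classified hnz, fun i j hi hj => ⟨tRel_of_isoPair hi hj, isoPair_of_tRel⟩⟩
end
end
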